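/- arXiv:1802.09385 — 3 statements merged into one kernel-verified Lean document; each statement's English description precedes it below -/
import Mathlib

section
/- Let N ∈ ℕ and T > 0 be fixed. Define K_t(φ) = (2π)^{-N} e^{tN²} ((-D)^N θ_t)(φ) for φ ∈ (0,π) and t > 0 (this is the heat kernel of the sphere S^{2N+1} expressed through the explicit odd-dimensional recurrence). Then there exist constants c, C > 0 (depending only on N and T) such that for all φ ∈ (0,π) and 0 < t ≤ T: c·(t+π−φ)^{-N}·t^{-(2N+1)/2}·exp(−φ²/(4t)) ≤ K_t(φ) ≤ C·(t+π−φ)^{-N}·t^{-(2N+1)/2}·exp(−φ²/(4t)). -/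
/-- The one-dimensional Gauss–Weierstrass kernel `W_t(x) = (4πt)^{-1/2} exp(-x²/(4t))`. -/
noncomputable def W (t x : ℝ) : ℝ :=
  (1 / Real.sqrt (4 * Real.pi * t)) * Real.exp (-x ^ 2 / (4 * t))

/-- The `2π`-periodization `θ_t(φ) = Σ_{n∈ℤ} W_t(φ + 2πn)` (heat kernel of the circle). -/
noncomputable def theta (t φ : ℝ) : ℝ := ∑' n : ℤ, W t (φ + 2 * Real.pi * n)

/-- The operator `f ↦ -(1/sin φ)·f'`. -/
noncomputable def negD (f : ℝ → ℝ) : ℝ → ℝ := fun φ => -(deriv f φ / Real.sin φ)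

open Polynomial in
theorem aux_deriv_succ (b c : ℕ → ℝ) (S : Finset ℕ) (N : ℕ) (u : ℝ) :
    (derivative^[N+1] (∏ i ∈ S, (C (b i) + C (c i) * X))).eval u
      = ∑ i ∈ S, c i * (derivative^[N] (∏ j ∈ S.erase i, (C (b j) + C (c j) * X))).eval u := by
  rw [Function.iterate_succ_apply, Polynomial.derivative_prod_finset, Polynomial.iterate_derivative_sum,
    Polynomial.eval_finsetSum]
  refine Finset.sum_congr rfl fun i _ => ?_
  have : derivative (C (b i) + C (c i) * X) = C (c i) := by simp
  rw [this, mul_comm, Polynomial.iterate_derivative_C_mul]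
  simp

open Polynomial in
theorem aux_eval_erase (b c : ℕ → ℝ) (S : Finset ℕ) (u : ℝ) (i : ℕ) (hi : i ∈ S)
    (h : 0 < b i + c i * u) :
    c i * (∏ j ∈ S.erase i, (C (b j) + C (c j) * X)).eval u
      = (∏ j ∈ S, (C (b j) + C (c j) * X)).eval u * (c i / (b i + c i * u)) := by
  rw [← Finset.mul_prod_erase S _ hi]
  simp only [eval_mul, eval_add, eval_C, eval_X]
  field_simp

open Polynomial in
theorem aux_eval_pos (b c : ℕ → ℝ) (S : Finset ℕ) (u : ℝ)
    (h : ∀ i, 0 < b i + c i * u) :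
    0 < (∏ j ∈ S, (C (b j) + C (c j) * X)).eval u := by
  rw [Polynomial.eval_prod]
  refine Finset.prod_pos fun i _ => ?_
  simpa using h i

open Polynomial in
theorem aux_upper (b c : ℕ → ℝ) (u : ℝ) (h : ∀ i, 0 < b i + c i * u) (hc : ∀ i, 0 ≤ c i)
    (N : ℕ) : ∀ S : Finset ℕ,
    (derivative^[N] (∏ i ∈ S, (C (b i) + C (c i) * X))).eval u
      ≤ (∏ i ∈ S, (C (b i) + C (c i) * X)).eval u * (∑ i ∈ S, c i / (b i + c i * u)) ^ N := by
  induction N with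
  | zero => intro S; simp
  | succ N ih =>
    intro S
    have ha : ∀ i, 0 ≤ c i / (b i + c i * u) := fun i => div_nonneg (hc i) (h i).le
    rw [aux_deriv_succ, pow_succ, ← mul_assoc, Finset.mul_sum]
    refine Finset.sum_le_sum fun i hi => ?_
    calc _ ≤ c i * ((∏ j ∈ S.erase i, (C (b j) + C (c j) * X)).eval u
            * (∑ j ∈ S.erase i, c j / (b j + c j * u)) ^ N) :=
          mul_le_mul_of_nonneg_left (ih _) (hc i)
      _ ≤ c i * ((∏ j ∈ S.erase i, (C (b j) + C (c j) * X)).eval u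
            * (∑ j ∈ S, c j / (b j + c j * u)) ^ N) := by
          refine mul_le_mul_of_nonneg_left (mul_le_mul_of_nonneg_left ?_
            (aux_eval_pos b c _ u h).le) (hc i)
          refine pow_le_pow_left₀ (Finset.sum_nonneg fun i _ => ha i) ?_ _
          exact Finset.sum_le_sum_of_subset_of_nonneg (Finset.erase_subset _ _) fun i _ _ => ha i
      _ = _ := by rw [← mul_assoc, aux_eval_erase b c S u i hi (h i)]; ring

open Polynomial in
theorem aux_lower (b c : ℕ → ℝ) (u : ℝ) (h : ∀ i, 0 < b i + c i * u) (hc : ∀ i, 0 ≤ c i)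
    (B : ℝ) (hB : 0 ≤ B) (N : ℕ) : ∀ S : Finset ℕ,
    (∀ R : Finset ℕ, R.card < N → B ≤ ∑ i ∈ S \ R, c i / (b i + c i * u)) →
    (∏ i ∈ S, (C (b i) + C (c i) * X)).eval u * B ^ N ≤
    (derivative^[N] (∏ i ∈ S, (C (b i) + C (c i) * X))).eval u := by
  induction N with
  | zero => intro S _; simp
  | succ N ih =>
    intro S hS
    have h0 := hS ∅ (by simp)
    rw [Finset.sdiff_empty] at h0
    have hP := aux_eval_pos b c S u h
    rw [aux_deriv_succ]
    calc _ = (∏ i ∈ S, (C (b i) + C (c i) * X)).eval u * B ^ N * B := by ring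
      _ ≤ (∏ i ∈ S, (C (b i) + C (c i) * X)).eval u * B ^ N
            * ∑ i ∈ S, c i / (b i + c i * u) := by gcongr
      _ = ∑ i ∈ S, c i * ((∏ j ∈ S.erase i, (C (b j) + C (c j) * X)).eval u * B ^ N) := by
          rw [Finset.mul_sum]
          refine Finset.sum_congr rfl fun i hi => ?_
          rw [← mul_assoc (c i), aux_eval_erase b c S u i hi (h i)]; ring
      _ ≤ _ := by
          refine Finset.sum_le_sum fun i hi => mul_le_mul_of_nonneg_left (ih _ ?_) (hc i)
          intro R hR
          have := hS (insert i R) (lt_of_le_of_lt (Finset.card_insert_le _ _) (by omega))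
          have e : S \ insert i R = S.erase i \ R := by
            ext x; simp; tauto
          rwa [e] at this

theorem aux_sum_upper (t s : ℝ) (ht : 0 < t) (hs : 0 ≤ s) (M : ℕ) :
    ∑ j ∈ Finset.range M, 1 / ((2 * (j:ℝ) + 1) * t + s) ^ 2 ≤ 2 / (t * (t + s)) := by
  have h : ∀ M : ℕ, ∑ j ∈ Finset.range M, 1 / ((2 * (j:ℝ) + 1) * t + s) ^ 2
      ≤ 2 / t * (1 / (t + s) - 1 / ((M + 1) * t + s)) := by
    intro M
    induction M with
    | zero => simp
    | succ M ih =>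
      rw [Finset.sum_range_succ]
      have hM : (0:ℝ) ≤ M := Nat.cast_nonneg M
      have key : 1 / ((2 * (M:ℝ) + 1) * t + s) ^ 2
          ≤ 2 / t * (1 / ((M + 1) * t + s) - 1 / ((M + 1 + 1) * t + s)) := by
        have e : 2 / t * (1 / ((M + 1) * t + s) - 1 / ((M + 1 + 1) * t + s))
          = 2 / (((M + 1) * t + s) * ((M + 1 + 1) * t + s)) := by
          have : (M + 1) * t + s ≠ 0 := by positivity
          have : (M + 1 + 1) * t + s ≠ 0 := by positivity
          field_simp
          ring
        rw [e, div_le_div_iff₀ (by positivity) (by positivity)]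
        have h1 : ((M + 1) * t + s) ≤ ((2 * (M:ℝ) + 1) * t + s) := by nlinarith
        have h2 : ((M + 1 + 1) * t + s) ≤ 2 * ((2 * (M:ℝ) + 1) * t + s) := by nlinarith
        have := mul_le_mul h1 h2 (by positivity) (by positivity)
        nlinarith
      push_cast
      calc _ ≤ _ := add_le_add ih key
        _ = _ := by ring
  refine (h M).trans ?_
  have : 0 ≤ 1 / (((M:ℝ) + 1) * t + s) := by positivity
  have h2 : 2 / (t * (t + s)) = 2 / t * (1 / (t+s)) := by field_simp
  rw [h2]
  gcongr
  linarith

theorem aux_cosh_lower (x φ : ℝ) (hφ : φ ∈ Set.Ioo 0 Real.pi) (hx : 0 ≤ x) :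
    (x + (Real.pi - φ)) ^ 2 / 10 ≤ Real.cosh x + Real.cos φ := by
  have h1 : 1 + x ^ 2 / 2 ≤ Real.cosh x := by
    have h := Real.cosh_two_mul (x / 2)
    have hcsq := Real.cosh_sq (x / 2)
    have hsinh : x / 2 ≤ Real.sinh (x / 2) := Real.self_le_sinh_iff.2 (by positivity)
    rw [show 2 * (x / 2) = x by ring] at h
    nlinarith
  have h2 := Real.cos_le_one_sub_mul_cos_sq (x := Real.pi - φ)
    (abs_le.2 ⟨by linarith [hφ.2, Real.pi_pos], by linarith [hφ.1]⟩)
  rw [Real.cos_pi_sub] at h2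
  have h3 : (1:ℝ) / 5 ≤ 2 / Real.pi ^ 2 := by
    rw [div_le_div_iff₀ (by norm_num) (by positivity)]
    nlinarith [Real.pi_lt_d2, Real.pi_pos]
  have h4 := mul_le_mul_of_nonneg_right h3 (sq_nonneg (Real.pi - φ))
  nlinarith [sq_nonneg (x - (Real.pi - φ)), sq_nonneg x]

theorem aux_cosh_upper (x φ X : ℝ) (hx : 0 ≤ x) (hX : x ≤ X) :
    Real.cosh x + Real.cos φ ≤ Real.exp (X^2/2) * (x ^ 2 + (Real.pi - φ)^2) := by
  have h1 := Real.cosh_le_exp_half_sq x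
  have h2 := Real.one_sub_sq_div_two_le_cos (x := Real.pi - φ)
  rw [Real.cos_pi_sub] at h2
  have h3 : Real.exp (x^2/2) ≤ Real.exp (X^2/2) := by gcongr
  have h4 : Real.exp (x^2/2) - 1 ≤ x^2/2 * Real.exp (x^2/2) := by
    have := Real.add_one_le_exp (-(x^2/2))
    have h5 : Real.exp (-(x^2/2)) * Real.exp (x^2/2) = 1 := by rw [← Real.exp_add]; simp
    nlinarith [Real.exp_pos (x^2/2)]
  have h6 : 1 ≤ Real.exp (x^2/2) := Real.one_le_exp (by positivity)
  nlinarith [sq_nonneg x, sq_nonneg (Real.pi - φ)]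

noncomputable def auxQ (q : ℝ) (n : ℕ) : ℝ := ∏ i ∈ Finset.range n, (1 - q ^ (2 * (i + 1)))
noncomputable def auxR (q : ℝ) (n : ℤ) : ℝ := if 0 ≤ n then (auxQ q n.toNat)⁻¹ else 0
noncomputable def auxA (q : ℝ) (M : ℕ) (k : ℤ) : ℝ :=
  q ^ (k ^ 2) * auxQ q (2 * M) * auxR q (M + k) * auxR q (M - k)

theorem auxQ_pos {q : ℝ} (h0 : 0 < q) (h1 : q < 1) (n : ℕ) : 0 < auxQ q n := by
  refine Finset.prod_pos fun i _ => ?_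
  have := pow_lt_one₀ h0.le h1 (n := 2 * (i + 1)) (by omega)
  linarith

theorem auxR_rec {q : ℝ} (h0 : 0 < q) (h1 : q < 1) (n : ℤ) :
    auxR q (n - 1) = (1 - (q ^ 2) ^ n) * auxR q n := by
  rcases lt_trichotomy n 0 with h | h | h
  · simp [auxR, show ¬ (0 ≤ n) by omega, show ¬ (1 ≤ n) by omega]
  · subst h; simp [auxR]
  · obtain ⟨m, rfl⟩ : ∃ m : ℕ, n = m + 1 := ⟨(n - 1).toNat, by omega⟩
    have e1 : ((m:ℤ) + 1 - 1) = m := by ring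
    have e2 : ((m:ℤ) + 1).toNat = m + 1 := by omega
    have e3 : (q ^ 2) ^ ((m:ℤ) + 1) = q ^ (2 * (m + 1)) := by
      rw [pow_mul]; exact_mod_cast rfl
    rw [e1, e3, auxR, auxR, if_pos (by omega), if_pos (by omega), e2, Int.toNat_natCast]
    have e4 : auxQ q (m + 1) = auxQ q m * (1 - q ^ (2 * (m + 1))) := by
      rw [auxQ, Finset.prod_range_succ, ← auxQ]
    rw [e4]
    have h3 := auxQ_pos h0 h1 m
    have h4 : 0 < 1 - q ^ (2 * (m + 1)) := by
      have := pow_lt_one₀ h0.le h1 (n := 2 * (m + 1)) (by omega)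
      linarith
    field_simp

theorem auxA_rec {q : ℝ} (h0 : 0 < q) (h1 : q < 1) (M : ℕ) (k : ℤ) :
    auxA q (M + 1) k = (1 + q ^ (4 * M + 2)) * auxA q M k
      + q ^ (2 * M + 1) * (auxA q M (k - 1) + auxA q M (k + 1)) := by
  have hq : q ≠ 0 := h0.ne'
  have r1 := auxR_rec h0 h1 (M + 1 + k)
  have r2 := auxR_rec h0 h1 (M + 1 - k)
  have r3 := auxR_rec h0 h1 (M + k)
  have r4 := auxR_rec h0 h1 (M - k)
  rw [show (M:ℤ) + 1 + k - 1 = M + k by ring] at r1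
  rw [show (M:ℤ) + 1 - k - 1 = M - k by ring] at r2
  rw [show (M:ℤ) + k - 1 = M + (k - 1) by ring] at r3
  rw [show (M:ℤ) - k - 1 = M - (k + 1) by ring] at r4
  simp only [auxA]
  push_cast
  rw [show (M:ℤ) - (k - 1) = M + 1 - k by ring, show (M:ℤ) + (k + 1) = M + 1 + k by ring,
    r3, r4, r1, r2]
  generalize auxR q (M + 1 + k) = x
  generalize auxR q (M + 1 - k) = y
  have eQ : auxQ q (2 * (M + 1)) = auxQ q (2 * M) * (1 - q ^ (4 * M + 2)) * (1 - q ^ (4 * M + 4)) := by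
    rw [show 2 * (M + 1) = 2 * M + 1 + 1 by ring, auxQ, Finset.prod_range_succ,
      Finset.prod_range_succ, ← auxQ]
    congr 3 <;> ring
  rw [eQ]
  generalize auxQ q (2 * M) = Z
  have z1 : q ^ ((k - 1) ^ 2) = q ^ (k ^ 2) * (q ^ k)⁻¹ ^ 2 * q := by
    rw [show (k - 1) ^ 2 = k ^ 2 + (-k) + (-k) + 1 by ring, zpow_add₀ hq, zpow_add₀ hq,
      zpow_add₀ hq, zpow_neg, zpow_one]; ring
  have z2 : q ^ ((k + 1) ^ 2) = q ^ (k ^ 2) * (q ^ k) ^ 2 * q := by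
    rw [show (k + 1) ^ 2 = k ^ 2 + k + k + 1 by ring, zpow_add₀ hq, zpow_add₀ hq,
      zpow_add₀ hq, zpow_one]; ring
  have hq2 : q ^ 2 ≠ 0 := by positivity
  have w : ∀ n : ℤ, (q ^ 2) ^ n = (q ^ n) ^ 2 := fun n => by
    rw [← zpow_natCast, ← zpow_natCast, ← zpow_mul, ← zpow_mul, mul_comm]
  have z3 : q ^ ((M:ℤ) + 1 + k) = q ^ M * q * q ^ k := by
    rw [zpow_add₀ hq, zpow_add₀ hq, zpow_one, zpow_natCast]
  have z4 : q ^ ((M:ℤ) + 1 - k) = q ^ M * q * (q ^ k)⁻¹ := by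
    rw [zpow_sub₀ hq, zpow_add₀ hq, zpow_one, zpow_natCast]; rfl
  have z5 : q ^ ((M:ℤ) + k) = q ^ M * q ^ k := by
    rw [zpow_add₀ hq, zpow_natCast]
  have z6 : q ^ ((M:ℤ) - k) = q ^ M * (q ^ k)⁻¹ := by
    rw [zpow_sub₀ hq, zpow_natCast]; rfl
  rw [z1, z2, w, w, w, w, z3, z4, z5, z6]
  have hk : q ^ k ≠ 0 := zpow_ne_zero _ hq
  generalize q ^ (k ^ 2) = Y
  generalize q ^ k = b at *
  rw [show 4 * M + 2 = M + M + M + M + 2 by ring, show 4 * M + 4 = M + M + M + M + 4 by ring,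
    show 2 * M + 1 = M + M + 1 by ring]
  simp only [pow_add]
  generalize q ^ M = m
  field_simp
  ring

theorem auxA_hasSum {q : ℝ} (h0 : 0 < q) (h1 : q < 1) (φ : ℝ) (M : ℕ) :
    HasSum (fun k : ℤ => auxA q M k * Real.cos (k * φ))
      (∏ j ∈ Finset.range M, (1 + q ^ (4 * j + 2) + 2 * q ^ (2 * j + 1) * Real.cos φ)) := by
  induction M with
  | zero =>
    have : ∀ k : ℤ, k ≠ 0 → auxA q 0 k * Real.cos (k * φ) = 0 := by
      intro k hk
      rcases lt_or_gt_of_ne hk with h | h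
      · simp [auxA, auxR, show ¬ (0 ≤ k) by omega]
      · simp [auxA, auxR, show ¬ (k ≤ 0) by omega]
    convert! hasSum_single (0:ℤ) this using 1
    simp [auxA, auxR, auxQ]
  | succ M ih =>
    have hs : ∀ w : ℤ → ℝ, Summable fun k : ℤ => auxA q M k * w k := by
      intro w
      refine summable_of_ne_finset_zero (s := Finset.Icc (-(M:ℤ)) M) fun k hk => ?_
      rw [Finset.mem_Icc, not_and_or] at hk
      rcases hk with h | h
      · simp [auxA, auxR, show ¬ (0 ≤ (M:ℤ) + k) by omega]
      · simp [auxA, auxR, show ¬ (k ≤ M) by omega]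
    have p1 := (hs fun k => Real.cos (((k + 1 : ℤ) : ℝ) * φ)).hasSum
    have p2 := (hs fun k => Real.cos (((k - 1 : ℤ) : ℝ) * φ)).hasSum
    have p3 := (p1.add p2).unique (a₂ := 2 * Real.cos φ * (∏ j ∈ Finset.range M,
        (1 + q ^ (4 * j + 2) + 2 * q ^ (2 * j + 1) * Real.cos φ))) (by
      convert! ih.mul_left (2 * Real.cos φ) using 1
      funext k
      push_cast
      rw [add_mul, sub_mul, one_mul, Real.cos_add, Real.cos_sub]
      ring)
    rw [← (Equiv.subRight (1:ℤ)).hasSum_iff] at p1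
    rw [← (Equiv.addRight (1:ℤ)).hasSum_iff] at p2
    rw [Finset.prod_range_succ]
    convert! ((ih.mul_left (1 + q ^ (4 * M + 2))).add ((p1.add p2).mul_left (q ^ (2 * M + 1)))) using 1
    · funext k
      rw [auxA_rec h0 h1]
      simp
      ring
    · rw [p3]; ring

theorem auxQ_lim {q : ℝ} (h0 : 0 < q) (h1 : q < 1) :
    ∃ L : ℝ, 0 < L ∧ (∀ n, L ≤ auxQ q n) ∧ (∀ n, auxQ q n ≤ 1) ∧
      Filter.Tendsto (auxQ q) Filter.atTop (nhds L) := by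
  have hq2 : q ^ 2 < 1 := pow_lt_one₀ h0.le h1 (by norm_num)
  have hlt : ∀ i : ℕ, q ^ (2 * (i + 1)) < 1 := fun i => pow_lt_one₀ h0.le h1 (by omega)
  have hs : Summable fun i : ℕ => ‖-(q ^ (2 * (i + 1)))‖ := by
    have : Summable fun i : ℕ => q ^ 2 * (q ^ 2) ^ i :=
      (summable_geometric_of_lt_one (by positivity) hq2).mul_left _
    refine this.congr fun i => ?_
    rw [norm_neg, Real.norm_of_nonneg (by positivity), pow_mul]; ring
  have hm := multipliable_one_add_of_summable hs
  have ht := hm.hasProd.tendsto_prod_nat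
  have hne : (∏' i : ℕ, (1 + -(q ^ (2 * (i + 1))))) ≠ 0 :=
    tprod_one_add_ne_zero_of_summable (fun i => by have := hlt i; linarith) hs
  have ht' : Filter.Tendsto (auxQ q) Filter.atTop (nhds (∏' i : ℕ, (1 + -(q ^ (2 * (i + 1)))))) := by
    refine ht.congr fun n => ?_
    rw [auxQ]; rfl
  have hanti : Antitone (auxQ q) := by
    refine antitone_nat_of_succ_le fun n => ?_
    have e : auxQ q (n + 1) = auxQ q n * (1 - q ^ (2 * (n + 1))) := by
      rw [auxQ, Finset.prod_range_succ, ← auxQ]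
    rw [e]
    have : 0 < q ^ (2 * (n + 1)) := by positivity
    nlinarith [auxQ_pos h0 h1 n]
  refine ⟨_, lt_of_le_of_ne (ge_of_tendsto' ht' fun n => (auxQ_pos h0 h1 n).le) hne.symm,
    fun n => hanti.le_of_tendsto ht' n, fun n => ?_, ht'⟩
  have := hanti (Nat.zero_le n)
  simpa [auxQ] using this

theorem aux_summable_sq {q : ℝ} (h0 : 0 < q) (h1 : q < 1) :
    Summable fun k : ℤ => q ^ (k ^ 2) := by
  have h : Summable fun n : ℕ => q ^ ((n:ℤ) ^ 2) := by
    refine Summable.of_nonneg_of_le (fun n => by positivity) (fun n => ?_)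
      (summable_geometric_of_lt_one h0.le h1)
    have : q ^ ((n:ℤ) ^ 2) = q ^ (n ^ 2) := by exact_mod_cast rfl
    rw [this]
    exact pow_le_pow_of_le_one h0.le h1.le (by nlinarith)
  refine Summable.of_nat_of_neg h ?_
  simpa using h

theorem aux_triple {q : ℝ} (h0 : 0 < q) (h1 : q < 1) : ∃ Z : ℝ, 0 < Z ∧ ∀ φ : ℝ,
    Filter.Tendsto (fun M => ∏ j ∈ Finset.range M,
      (1 + q ^ (4 * j + 2) + 2 * q ^ (2 * j + 1) * Real.cos φ)) Filter.atTop
      (nhds (Z * ∑' k : ℤ, q ^ (k ^ 2) * Real.cos (k * φ))) := by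
  obtain ⟨L, hL, hLle, hle1, hlim⟩ := auxQ_lim h0 h1
  refine ⟨L⁻¹, by positivity, fun φ => ?_⟩
  have e : ∀ M, ∏ j ∈ Finset.range M, (1 + q ^ (4 * j + 2) + 2 * q ^ (2 * j + 1) * Real.cos φ)
      = ∑' k : ℤ, auxA q M k * Real.cos (k * φ) := fun M => (auxA_hasSum h0 h1 φ M).tsum_eq.symm
  simp_rw [e]
  rw [← tsum_mul_left]
  have hR0 : ∀ n, 0 ≤ auxR q n := by
    intro n; rw [auxR]; split_ifs
    · exact inv_nonneg.2 (auxQ_pos h0 h1 _).le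
    · exact le_rfl
  have hR1 : ∀ n, auxR q n ≤ L⁻¹ := by
    intro n; rw [auxR]; split_ifs
    · exact inv_anti₀ hL (hLle _)
    · positivity
  have hRlim : Filter.Tendsto (auxR q) Filter.atTop (nhds L⁻¹) := by
    have h1 : Filter.Tendsto (fun n : ℤ => (auxQ q n.toNat)⁻¹) Filter.atTop (nhds L⁻¹) := by
      refine (hlim.comp ?_).inv₀ hL.ne'
      refine Filter.tendsto_atTop_atTop.2 fun b => ⟨b, fun n hn => by omega⟩
    refine h1.congr' ?_
    filter_upwards [Filter.eventually_ge_atTop 0] with n hn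
    rw [auxR, if_pos hn]
  refine tendsto_tsum_of_dominated_convergence (bound := fun k : ℤ => q ^ (k ^ 2) * (L⁻¹ * L⁻¹))
    ((aux_summable_sq h0 h1).mul_right _) (fun k => ?_) (Filter.Eventually.of_forall fun M k => ?_)
  · have t1 : Filter.Tendsto (fun M : ℕ => auxQ q (2 * M)) Filter.atTop (nhds L) :=
      hlim.comp (Filter.tendsto_atTop_atTop.2 fun b => ⟨b, fun n hn => by omega⟩)
    have t2 : Filter.Tendsto (fun M : ℕ => auxR q (M + k)) Filter.atTop (nhds L⁻¹) :=
      hRlim.comp (Filter.tendsto_atTop_atTop.2 fun b => ⟨(b - k).toNat, fun n hn => by omega⟩)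
    have t3 : Filter.Tendsto (fun M : ℕ => auxR q (M - k)) Filter.atTop (nhds L⁻¹) :=
      hRlim.comp (Filter.tendsto_atTop_atTop.2 fun b => ⟨(b + k).toNat, fun n hn => by omega⟩)
    have := (((t1.const_mul (q ^ (k ^ 2))).mul t2).mul t3).mul_const (Real.cos (k * φ))
    convert! this using 2
    field_simp
  · have hA : 0 ≤ auxA q M k := by
      have := hR0 (M + k); have := hR0 (M - k); have := auxQ_pos h0 h1 (2 * M)
      rw [auxA]; positivity
    rw [Real.norm_eq_abs, abs_mul, abs_of_nonneg hA]
    calc _ ≤ auxA q M k * 1 := by gcongr; exact Real.abs_cos_le_one _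
      _ = q ^ (k ^ 2) * (auxQ q (2 * M) * auxR q (M + k) * auxR q (M - k)) := by rw [auxA]; ring
      _ ≤ q ^ (k ^ 2) * (1 * L⁻¹ * L⁻¹) := by
        have := hR0 (M + k); have := hR0 (M - k); have := auxQ_pos h0 h1 (2 * M)
        gcongr
        · exact hle1 _
        · exact hR1 _
        · exact hR1 _
      _ = _ := by ring

open Polynomial in
theorem aux_limit {q : ℝ} (h0 : 0 < q) (h1 : q < 1) :
    ∃ g : ℕ → ℝ → ℝ, (∀ k u, |u| < 2 → HasDerivAt (g k) (g (k+1) u) u) ∧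
      ∀ k u, |u| < 2 → Filter.Tendsto (fun M : ℕ => (derivative^[k] (∏ i ∈ Finset.range M,
        (C (1 + q ^ (4 * i + 2)) + C (2 * q ^ (2 * i + 1)) * X))).eval u) Filter.atTop
        (nhds (g k u)) := by
  set P : ℕ → ℝ[X] := fun M => ∏ i ∈ Finset.range M,
        (C (1 + q ^ (4 * i + 2)) + C (2 * q ^ (2 * i + 1)) * X) with hP
  set f : ℕ → ℂ → ℂ := fun n u => (q:ℂ) ^ (4 * n + 2) + 2 * (q:ℂ) ^ (2 * n + 1) * u with hf
  set U : Set ℂ := Metric.ball 0 2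
  have hU : IsOpen U := Metric.isOpen_ball
  have hprod := Summable.hasProdLocallyUniformlyOn_nat_one_add (f := f) (K := U) hU
    (u := fun n => 5 * q ^ n) ((summable_geometric_of_lt_one h0.le h1).mul_left _)
    (Filter.Eventually.of_forall fun n u hu => by
      have hu' : ‖u‖ ≤ 2 := by simpa [U] using (mem_ball_zero_iff.1 hu).le
      calc ‖f n u‖ ≤ ‖(q:ℂ) ^ (4 * n + 2)‖ + ‖2 * (q:ℂ) ^ (2 * n + 1) * u‖ := norm_add_le _ _
        _ = q ^ (4 * n + 2) + 2 * q ^ (2 * n + 1) * ‖u‖ := by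
          simp [abs_of_pos h0]
        _ ≤ q ^ n + 2 * q ^ n * 2 := by
          gcongr ?_ + 2 * ?_ * ?_
          · exact pow_le_pow_of_le_one h0.le h1.le (by omega)
          · exact pow_le_pow_of_le_one h0.le h1.le (by omega)
        _ = 5 * q ^ n := by ring)
    (fun n => by fun_prop)
  have hlim := hprod.tendstoLocallyUniformlyOn_finsetRange
  set G : ℂ → ℂ := fun x => ∏' i, (1 + f i x)
  have key : ∀ k, TendstoLocallyUniformlyOn
      (fun M (u:ℂ) => ((derivative^[k] (P M)).map (algebraMap ℝ ℂ)).eval u) (deriv^[k] G)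
      Filter.atTop U := by
    intro k
    induction k with
    | zero =>
      refine hlim.congr fun M x hx => ?_
      simp [hP, hf, Polynomial.map_prod, Polynomial.eval_prod, add_assoc]
    | succ k ih =>
      have := ih.deriv (Filter.Eventually.of_forall fun M =>
        (Polynomial.differentiable _).differentiableOn) hU
      rw [Function.iterate_succ_apply']
      refine this.congr fun M x hx => ?_
      simp [Function.iterate_succ_apply']
  have hmem : ∀ u : ℝ, |u| < 2 → (u : ℂ) ∈ U := fun u hu => by
    simpa [U] using hu
  refine ⟨fun k u => (deriv^[k] G (u:ℂ)).re, fun k u hu => ?_, fun k u hu => ?_⟩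
  · have hd : DifferentiableOn ℂ (deriv^[k] G) U := (key k).differentiableOn
      (Filter.Eventually.of_forall fun M => (Polynomial.differentiable _).differentiableOn) hU
    have := ((hd.differentiableAt (hU.mem_nhds (hmem u hu))).hasDerivAt).real_of_complex
    rw [← Function.iterate_succ_apply' deriv] at this
    exact this
  · have := (key k).tendsto_at (hmem u hu)
    refine ((Complex.continuous_re.tendsto _).comp this).congr fun M => ?_
    simp only [Function.comp]
    rw [Polynomial.eval_map_algebraMap]
    rw [← Complex.coe_algebraMap, Polynomial.aeval_algebraMap_apply, Complex.coe_algebraMap, Complex.ofReal_re,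
      Polynomial.coe_aeval_eq_eval]

theorem aux_exp_int_mul (x : ℝ) (n : ℤ) : Real.exp (n * x) = Real.exp x ^ n := by
  exact_mod_cast Complex.exp_int_mul x n

theorem theta_eq (t : ℝ) (ht : 0 < t) : ∃ κ : ℝ, 0 < κ ∧ ∀ φ,
    theta t φ = κ * ∑' k : ℤ, (Real.exp (-t)) ^ (k ^ 2) * Real.cos (k * φ) := by
  have hpi := Real.pi_pos
  refine ⟨1 / Real.sqrt (4 * Real.pi * t) * (t / Real.pi) ^ (1 / 2 : ℝ), by positivity, fun φ => ?_⟩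
  have h := Complex.tsum_exp_neg_quadratic (a := ((t / Real.pi : ℝ) : ℂ))
    (by rw [Complex.ofReal_re]; positivity) (-(Complex.I * φ / (2 * Real.pi)))
  have hpc : (Real.pi : ℂ) ≠ 0 := by exact_mod_cast hpi.ne'
  have htc : (t : ℂ) ≠ 0 := by exact_mod_cast ht.ne'
  have e1 : ∀ n : ℤ, Complex.exp (-Real.pi / ((t / Real.pi : ℝ) : ℂ) *
      (n + Complex.I * (-(Complex.I * φ / (2 * Real.pi)))) ^ 2)
      = ((Real.exp (-(φ + 2 * Real.pi * n) ^ 2 / (4 * t)) : ℝ) : ℂ) := by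
    intro n
    push_cast
    congr 1
    have : Complex.I * (-(Complex.I * φ / (2 * Real.pi))) = φ / (2 * Real.pi) := by
      rw [mul_neg, ← mul_div_assoc, ← mul_assoc, Complex.I_mul_I]; ring
    rw [this]
    field_simp
    ring
  have e2 : ∀ n : ℤ, Complex.exp (-Real.pi * ((t / Real.pi : ℝ) : ℂ) * n ^ 2 +
      2 * Real.pi * (-(Complex.I * φ / (2 * Real.pi))) * n)
      = ((Real.exp (-t) ^ (n ^ 2) : ℝ) : ℂ) * Complex.exp (((-(n * φ) : ℝ) : ℂ) * Complex.I) := by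
    intro n
    rw [← aux_exp_int_mul, Complex.ofReal_exp, ← Complex.exp_add]
    congr 1
    push_cast
    field_simp
  have e3 : (((t / Real.pi : ℝ) : ℂ)) ^ (1 / 2 : ℂ) = (((t / Real.pi) ^ (1 / 2 : ℝ) : ℝ) : ℂ) := by
    rw [Complex.ofReal_cpow (by positivity)]; norm_num
  simp_rw [e1, e2] at h
  rw [e3] at h
  have hq0 := Real.exp_pos (-t)
  have hq1 : Real.exp (-t) < 1 := by rw [Real.exp_lt_one_iff]; linarith
  have hsum : Summable fun n : ℤ => ((Real.exp (-t) ^ (n ^ 2) : ℝ) : ℂ) *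
      Complex.exp (((-(n * φ) : ℝ) : ℂ) * Complex.I) := by
    refine Summable.of_norm ?_
    refine (aux_summable_sq hq0 hq1).congr fun n => ?_
    rw [norm_mul, Complex.norm_exp_ofReal_mul_I, mul_one, Complex.norm_real,
      Real.norm_of_nonneg (by positivity)]
  have h2 := congrArg Complex.re h
  rw [Complex.re_tsum hsum, ← Complex.ofReal_tsum, ← Complex.ofReal_one, ← Complex.ofReal_div,
    ← Complex.ofReal_mul, Complex.ofReal_re] at h2
  have e4 : ∀ n : ℤ, (((Real.exp (-t) ^ (n ^ 2) : ℝ) : ℂ) *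
      Complex.exp (((-(n * φ) : ℝ) : ℂ) * Complex.I)).re
      = Real.exp (-t) ^ (n ^ 2) * Real.cos (n * φ) := by
    intro n
    rw [Complex.re_ofReal_mul, Complex.exp_ofReal_mul_I_re, Real.cos_neg]
  simp_rw [e4] at h2
  rw [h2, theta]
  simp only [W]
  rw [tsum_mul_left]
  have : (t / Real.pi) ^ (1 / 2 : ℝ) ≠ 0 := by positivity
  field_simp

theorem theta_bounds (T : ℝ) (hT : 0 < T) : ∃ C : ℝ, 0 < C ∧ ∀ φ t : ℝ, φ ∈ Set.Ioo 0 Real.pi →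
    0 < t → t ≤ T → W t φ ≤ theta t φ ∧ theta t φ ≤ C * W t φ := by
  have hpi := Real.pi_pos
  set q := Real.exp (-(Real.pi ^ 2 / T)) with hq
  have hq0 : 0 < q := Real.exp_pos _
  have hq1 : q < 1 := by
    rw [hq, Real.exp_lt_one_iff]
    have : 0 < Real.pi ^ 2 / T := by positivity
    linarith
  have hs : Summable fun n : ℤ => q ^ (n ^ 2 - |n|) := by
    have h : Summable fun n : ℕ => q ^ ((n:ℤ) ^ 2 - |(n:ℤ)|) := by
      refine Summable.of_nonneg_of_le (fun n => by positivity) (fun n => ?_)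
        ((summable_geometric_of_lt_one hq0.le hq1).mul_left q⁻¹)
      have : q⁻¹ * q ^ n = q ^ ((n:ℤ) - 1) := by
        rw [zpow_sub₀ hq0.ne', zpow_natCast, zpow_one]; field_simp
      rw [this]
      refine zpow_le_zpow_right_of_le_one₀ hq0 hq1.le ?_
      rw [Nat.abs_cast]
      nlinarith [sq_nonneg ((n:ℤ) - 1)]
    refine Summable.of_nat_of_neg h ?_
    simpa using h
  have hpt : ∀ φ t : ℝ, φ ∈ Set.Ioo 0 Real.pi → 0 < t → t ≤ T → ∀ n : ℤ,
      W t (φ + 2 * Real.pi * n) ≤ q ^ (n ^ 2 - |n|) * W t φ := by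
    intro φ t hφ ht htT n
    have hn : (0:ℤ) ≤ n ^ 2 - |n| := by
      rw [← sq_abs]
      rcases (abs_nonneg n).eq_or_lt with h | h
      · simp [← h]
      · nlinarith
    have hn' : (0:ℝ) ≤ (n:ℝ) ^ 2 - |(n:ℝ)| := by exact_mod_cast hn
    have e : q ^ (n ^ 2 - |n|) = Real.exp (((n:ℝ) ^ 2 - |(n:ℝ)|) * (-(Real.pi ^ 2 / T))) := by
      rw [hq, ← aux_exp_int_mul]; push_cast; rfl
    rw [e, W, W, mul_left_comm, ← Real.exp_add]
    gcongr
    have h1 : ((n:ℝ) ^ 2 - |(n:ℝ)|) * (Real.pi ^ 2 / T) ≤ ((n:ℝ) ^ 2 - |(n:ℝ)|) * (Real.pi ^ 2 / t) := by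
      gcongr
    have h2 : -(|(n:ℝ)| * Real.pi) ≤ n * φ := by
      have : |(n:ℝ) * φ| ≤ |(n:ℝ)| * Real.pi := by
        rw [abs_mul, abs_of_pos hφ.1]; gcongr; exact hφ.2.le
      exact (neg_le_neg this).trans (neg_abs_le _)
    have h3 : -(φ + 2 * Real.pi * n) ^ 2 / (4 * t) ≤
        -φ ^ 2 / (4 * t) - ((n:ℝ) ^ 2 - |(n:ℝ)|) * (Real.pi ^ 2 / t) := by
      rw [show -φ ^ 2 / (4 * t) - ((n:ℝ) ^ 2 - |(n:ℝ)|) * (Real.pi ^ 2 / t)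
        = (-φ ^ 2 - ((n:ℝ) ^ 2 - |(n:ℝ)|) * Real.pi ^ 2 * 4) / (4 * t) by field_simp]
      gcongr
      nlinarith
    linarith
  have hW : ∀ t x, 0 ≤ W t x := fun t x => by rw [W]; positivity
  refine ⟨∑' n : ℤ, q ^ (n ^ 2 - |n|), hs.tsum_pos (fun n => by positivity) 0 (by positivity),
    fun φ t hφ ht htT => ?_⟩
  have hs2 : Summable fun n : ℤ => W t (φ + 2 * Real.pi * n) :=
    Summable.of_nonneg_of_le (fun n => hW _ _) (hpt φ t hφ ht htT) (hs.mul_right _)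
  constructor
  · have := hs2.le_tsum 0 (fun n _ => hW _ _)
    simpa [theta] using this
  · rw [← tsum_mul_right]
    exact hs2.tsum_le_tsum (hpt φ t hφ ht htT) (hs.mul_right _)


theorem aux_ratio (t u : ℝ) (i : ℕ) :
    (1 + Real.exp (-t) ^ (4 * i + 2)) + 2 * Real.exp (-t) ^ (2 * i + 1) * u
      = 2 * Real.exp (-t) ^ (2 * i + 1) * (Real.cosh ((2 * (i:ℝ) + 1) * t) + u) := by
  have e : Real.exp (-t) ^ (2 * i + 1) = Real.exp (-((2 * (i:ℝ) + 1) * t)) := by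
    rw [← Real.exp_nat_mul]; push_cast; congr 1; ring
  rw [show 4 * i + 2 = (2 * i + 1) * 2 by ring, pow_mul, e, Real.cosh_eq]
  have : Real.exp (-((2 * (i:ℝ) + 1) * t)) * Real.exp ((2 * (i:ℝ) + 1) * t) = 1 := by
    rw [← Real.exp_add]; simp
  linear_combination -this

theorem aux_ratio' (t u : ℝ) (i : ℕ) :
    2 * Real.exp (-t) ^ (2 * i + 1) /
      ((1 + Real.exp (-t) ^ (4 * i + 2)) + 2 * Real.exp (-t) ^ (2 * i + 1) * u)
      = 1 / (Real.cosh ((2 * (i:ℝ) + 1) * t) + u) := by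
  rw [aux_ratio, div_mul_eq_div_div, div_self (by positivity)]

theorem aux_sum_a_upper (φ t : ℝ) (hφ : φ ∈ Set.Ioo 0 Real.pi) (ht : 0 < t) (M : ℕ) :
    ∑ i ∈ Finset.range M, 1 / (Real.cosh ((2 * (i:ℝ) + 1) * t) + Real.cos φ)
      ≤ 20 / (t * (t + (Real.pi - φ))) := by
  have hs : 0 < Real.pi - φ := by linarith [hφ.2]
  calc _ ≤ ∑ i ∈ Finset.range M, 10 * (1 / ((2 * (i:ℝ) + 1) * t + (Real.pi - φ)) ^ 2) := by
        refine Finset.sum_le_sum fun i _ => ?_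
        have h := aux_cosh_lower ((2 * (i:ℝ) + 1) * t) φ hφ (by positivity)
        have h2 := one_div_le_one_div_of_le (by positivity) h
        refine h2.trans (le_of_eq ?_)
        rw [one_div_div]; ring
    _ ≤ 10 * (2 / (t * (t + (Real.pi - φ)))) := by
        rw [← Finset.mul_sum]
        exact mul_le_mul_of_nonneg_left (aux_sum_upper t _ ht hs.le M) (by norm_num)
    _ = _ := by ring

theorem aux_sum_a_lower (N : ℕ) (T : ℝ) (hT : 0 < T) : ∃ c : ℝ, 0 < c ∧
    ∀ φ t : ℝ, φ ∈ Set.Ioo 0 Real.pi → 0 < t → t ≤ T → ∃ m : ℕ, ∀ M, m ≤ M →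
      ∀ R : Finset ℕ, R.card < N → c / (t * (t + (Real.pi - φ))) ≤
        ∑ i ∈ Finset.range M \ R, 1 / (Real.cosh ((2 * (i:ℝ) + 1) * t) + Real.cos φ) := by
  set L : ℝ := 2 * N + 5 with hL
  set E : ℝ := Real.exp ((L * (T + Real.pi)) ^ 2 / 2) with hE
  have hE0 : 0 < E := Real.exp_pos _
  have hN0 : (0:ℝ) ≤ N := Nat.cast_nonneg N
  have hL0 : 0 < L := by positivity
  refine ⟨1 / (E * (L ^ 2 + 1)), by positivity, fun φ t hφ ht htT => ?_⟩
  set s : ℝ := Real.pi - φ with hs'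
  have hs : 0 < s := by linarith [hφ.2]
  have hspi : s ≤ Real.pi := by linarith [hφ.1]
  set k : ℕ := ⌈(t + s) / t⌉₊ with hk
  have hk1 : (t + s) / t ≤ k := Nat.le_ceil _
  have hk2 : (k:ℝ) < (t + s) / t + 1 := Nat.ceil_lt_add_one (by positivity)
  have hk2' : k * t ≤ 2 * t + s := by
    have := mul_le_mul_of_nonneg_right hk2.le ht.le
    rw [add_mul, div_mul_cancel₀ _ ht.ne'] at this
    linarith
  refine ⟨N + k, fun M hM R hR => ?_⟩
  have hpos : ∀ i : ℕ, 0 < Real.cosh ((2 * (i:ℝ) + 1) * t) + Real.cos φ := fun i =>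
    lt_of_lt_of_le (by positivity) (aux_cosh_lower ((2 * (i:ℝ) + 1) * t) φ hφ (by positivity))
  have hterm : ∀ i ∈ Finset.range (N + k) \ R, 1 / (E * (L ^ 2 + 1) * (t + s) ^ 2) ≤
      1 / (Real.cosh ((2 * (i:ℝ) + 1) * t) + Real.cos φ) := by
    intro i hi
    have hi' : i + 1 ≤ N + k := by
      have := (Finset.mem_sdiff.1 hi).1
      rw [Finset.mem_range] at this; omega
    have hi2 : (i:ℝ) + 1 ≤ N + k := by exact_mod_cast hi'
    refine one_div_le_one_div_of_le (hpos i) ?_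
    have hx : (2 * (i:ℝ) + 1) * t ≤ L * (t + s) := by
      have := mul_le_mul_of_nonneg_right hi2 ht.le
      nlinarith [mul_nonneg hN0 hs.le]
    have hX : L * (t + s) ≤ L * (T + Real.pi) := by gcongr
    have h := aux_cosh_upper ((2 * (i:ℝ) + 1) * t) φ (L * (T + Real.pi)) (by positivity)
      (hx.trans hX)
    refine h.trans ?_
    rw [← hE, mul_assoc, ← hs']
    refine mul_le_mul_of_nonneg_left ?_ hE0.le
    have h1 := pow_le_pow_left₀ (by positivity) hx 2
    nlinarith
  have hcard : k ≤ (Finset.range (N + k) \ R).card := by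
    have := Finset.le_card_sdiff R (Finset.range (N + k))
    rw [Finset.card_range] at this
    omega
  calc 1 / (E * (L ^ 2 + 1)) / (t * (t + s))
      = (t + s) / t * (1 / (E * (L ^ 2 + 1) * (t + s) ^ 2)) := by field_simp
    _ ≤ ((Finset.range (N + k) \ R).card : ℝ) * (1 / (E * (L ^ 2 + 1) * (t + s) ^ 2)) := by
        have : (k:ℝ) ≤ ((Finset.range (N + k) \ R).card : ℝ) := by exact_mod_cast hcard
        have := hk1.trans this
        gcongr
    _ ≤ ∑ i ∈ Finset.range (N + k) \ R,
          1 / (Real.cosh ((2 * (i:ℝ) + 1) * t) + Real.cos φ) := by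
        rw [← nsmul_eq_mul]
        exact Finset.card_nsmul_le_sum _ _ _ hterm
    _ ≤ _ := by
        refine Finset.sum_le_sum_of_subset_of_nonneg ?_ fun i _ _ =>
          (one_div_pos.2 (hpos i)).le
        exact Finset.sdiff_subset_sdiff (Finset.range_mono hM) (le_refl _)

theorem aux_negD_iter (f : ℝ → ℝ) (K : ℝ) (g : ℕ → ℝ → ℝ)
    (hg : ∀ k u, |u| < 2 → HasDerivAt (g k) (g (k+1) u) u)
    (hf : ∀ φ, f φ = K * g 0 (Real.cos φ)) (k : ℕ) :
    ∀ φ ∈ Set.Ioo 0 Real.pi, negD^[k] f φ = K * g k (Real.cos φ) := by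
  induction k with
  | zero => intro φ _; exact hf φ
  | succ k ih =>
    intro φ hφ
    rw [Function.iterate_succ_apply', negD]
    have hev : negD^[k] f =ᶠ[nhds φ] fun φ => K * g k (Real.cos φ) :=
      Filter.eventuallyEq_of_mem (isOpen_Ioo.mem_nhds hφ) ih
    have hc : |Real.cos φ| < 2 := lt_of_le_of_lt (Real.abs_cos_le_one φ) (by norm_num)
    have hd := (((hg k (Real.cos φ) hc).comp φ (Real.hasDerivAt_cos φ)).const_mul K)
    have hd' : deriv (fun φ => K * g k (Real.cos φ)) φ
      = K * (g (k+1) (Real.cos φ) * -Real.sin φ) := hd.deriv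
    rw [hev.deriv_eq, hd']
    have := (Real.sin_pos_of_pos_of_lt_pi hφ.1 hφ.2).ne'
    field_simp

theorem aux_core (N : ℕ) (T : ℝ) (hT : 0 < T) : ∃ c : ℝ, 0 < c ∧
    ∀ φ t : ℝ, φ ∈ Set.Ioo 0 Real.pi → 0 < t → t ≤ T →
      theta t φ * (c / (t * (t + (Real.pi - φ)))) ^ N ≤ negD^[N] (theta t) φ ∧
      negD^[N] (theta t) φ ≤ theta t φ * (20 / (t * (t + (Real.pi - φ)))) ^ N := by
  obtain ⟨c, hc, H⟩ := aux_sum_a_lower N T hT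
  refine ⟨c, hc, fun φ t hφ ht htT => ?_⟩
  obtain ⟨m, hm⟩ := H φ t hφ ht htT
  have hq0 := Real.exp_pos (-t)
  have hq1 : Real.exp (-t) < 1 := by rw [Real.exp_lt_one_iff]; linarith
  obtain ⟨g, hg, hlim⟩ := aux_limit hq0 hq1
  obtain ⟨Z, hZ, htrip⟩ := aux_triple hq0 hq1
  obtain ⟨κ, hκ, hth⟩ := theta_eq t ht
  have hcos : ∀ φ, |Real.cos φ| < 2 := fun φ =>
    lt_of_le_of_lt (Real.abs_cos_le_one φ) (by norm_num)
  have hθ : ∀ φ, theta t φ = κ / Z * g 0 (Real.cos φ) := by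
    intro φ
    have h1 := hlim 0 (Real.cos φ) (hcos φ)
    simp only [Function.iterate_zero, id, Polynomial.eval_prod, Polynomial.eval_add,
      Polynomial.eval_mul, Polynomial.eval_C, Polynomial.eval_X] at h1
    have h2 := tendsto_nhds_unique h1 (htrip φ)
    rw [h2, hth, ← mul_assoc, div_mul_cancel₀ _ hZ.ne']
  rw [aux_negD_iter (theta t) (κ / Z) g hg hθ N φ hφ, hθ φ, mul_assoc, mul_assoc]
  have hpos : ∀ i : ℕ, 0 < (1 + Real.exp (-t) ^ (4 * i + 2)) +
      2 * Real.exp (-t) ^ (2 * i + 1) * Real.cos φ := by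
    intro i
    rw [aux_ratio]
    have hs : 0 < Real.pi - φ := by linarith [hφ.2]
    have : 0 < Real.cosh ((2 * (i:ℝ) + 1) * t) + Real.cos φ :=
      lt_of_lt_of_le (by positivity) (aux_cosh_lower ((2 * (i:ℝ) + 1) * t) φ hφ (by positivity))
    positivity
  have hcn : ∀ i : ℕ, 0 ≤ 2 * Real.exp (-t) ^ (2 * i + 1) := fun i => by positivity
  have hs : 0 < Real.pi - φ := by linarith [hφ.2]
  have hl0 := hlim 0 (Real.cos φ) (hcos φ)
  have hlN := hlim N (Real.cos φ) (hcos φ)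
  simp only [Function.iterate_zero, id] at hl0
  constructor
  · refine mul_le_mul_of_nonneg_left ?_ (by positivity)
    refine le_of_tendsto_of_tendsto (hl0.mul_const _) hlN ?_
    filter_upwards [Filter.eventually_ge_atTop m] with M hM
    refine aux_lower _ _ _ hpos hcn _ (by positivity) N _ fun R hR => ?_
    simp_rw [aux_ratio']
    exact hm M hM R hR
  · refine mul_le_mul_of_nonneg_left ?_ (by positivity)
    refine le_of_tendsto_of_tendsto' hlN (hl0.mul_const _) fun M => ?_
    refine (aux_upper _ _ _ hpos hcn N _).trans ?_
    refine mul_le_mul_of_nonneg_left ?_ (aux_eval_pos _ _ _ _ hpos).le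
    refine pow_le_pow_left₀ (Finset.sum_nonneg fun i _ => div_nonneg (hcn i) (hpos i).le) ?_ _
    simp_rw [aux_ratio']
    exact aux_sum_a_upper φ t hφ ht M

theorem aux_W_eq (N : ℕ) (φ t : ℝ) (hφ : φ ∈ Set.Ioo 0 Real.pi) (ht : 0 < t) (a : ℝ) :
    W t φ * (a / (t * (t + (Real.pi - φ)))) ^ N = a ^ N / Real.sqrt (4 * Real.pi) *
      ((t + Real.pi - φ) ^ (-(N : ℝ)) * t ^ (-(2 * (N : ℝ) + 1) / 2) *
            Real.exp (-φ ^ 2 / (4 * t))) := by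
  have hs : 0 < t + (Real.pi - φ) := by linarith [hφ.2]
  have e1 : (t + Real.pi - φ) ^ (-(N : ℝ)) = ((t + (Real.pi - φ)) ^ N)⁻¹ := by
    rw [show t + Real.pi - φ = t + (Real.pi - φ) by ring, Real.rpow_neg hs.le, Real.rpow_natCast]
  have e2 : t ^ (-(2 * (N : ℝ) + 1) / 2) = (t ^ N)⁻¹ * (Real.sqrt t)⁻¹ := by
    rw [show -(2 * (N : ℝ) + 1) / 2 = -(N:ℝ) + -(1/2) by ring, Real.rpow_add ht,
      Real.rpow_neg ht.le, Real.rpow_neg ht.le, Real.rpow_natCast, Real.sqrt_eq_rpow]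
  rw [e1, e2, W, Real.sqrt_mul (by positivity), div_pow, mul_pow]
  have : 0 < Real.sqrt t := Real.sqrt_pos.2 ht
  have : 0 < Real.sqrt (4 * Real.pi) := Real.sqrt_pos.2 (by positivity)
  field_simp

/-- Sharp two-sided estimate for the heat kernel
`K_t(φ) = (2π)^{-N} e^{tN²} ((-D)^N θ_t)(φ)` of the sphere `S^{2N+1}`, for `0 < t ≤ T`. -/
theorem sphere_heat_kernel_odd_dim_sharp_estimate (N : ℕ) (T : ℝ) (hT : 0 < T) :
    ∃ c C : ℝ, 0 < c ∧ 0 < C ∧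
      ∀ φ t : ℝ, φ ∈ Set.Ioo 0 Real.pi → 0 < t → t ≤ T →
        c * (t + Real.pi - φ) ^ (-(N : ℝ)) * t ^ (-(2 * (N : ℝ) + 1) / 2) *
            Real.exp (-φ ^ 2 / (4 * t)) ≤
          (2 * Real.pi) ^ (-(N : ℝ)) * Real.exp (t * (N : ℝ) ^ 2) * (negD^[N] (theta t)) φ ∧
        (2 * Real.pi) ^ (-(N : ℝ)) * Real.exp (t * (N : ℝ) ^ 2) * (negD^[N] (theta t)) φ ≤
          C * (t + Real.pi - φ) ^ (-(N : ℝ)) * t ^ (-(2 * (N : ℝ) + 1) / 2) *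
            Real.exp (-φ ^ 2 / (4 * t)) := by
  have hpi := Real.pi_pos
  obtain ⟨c, hc, hcore⟩ := aux_core N T hT
  obtain ⟨C, hC, hth⟩ := theta_bounds T hT
  have hA : 0 < (2 * Real.pi) ^ (-(N : ℝ)) := by positivity
  have hS : 0 < Real.sqrt (4 * Real.pi) := Real.sqrt_pos.2 (by positivity)
  refine ⟨(2 * Real.pi) ^ (-(N : ℝ)) * (c ^ N / Real.sqrt (4 * Real.pi)),
    (2 * Real.pi) ^ (-(N : ℝ)) * Real.exp (T * (N : ℝ) ^ 2) *
      (C * (20 ^ N / Real.sqrt (4 * Real.pi))), by positivity, by positivity,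
    fun φ t hφ ht htT => ?_⟩
  obtain ⟨h1, h2⟩ := hcore φ t hφ ht htT
  obtain ⟨h3, h4⟩ := hth φ t hφ ht htT
  have hs : 0 < Real.pi - φ := by linarith [hφ.2]
  have hW : 0 ≤ W t φ := by rw [W]; positivity
  have hlow : W t φ * (c / (t * (t + (Real.pi - φ)))) ^ N ≤ negD^[N] (theta t) φ :=
    le_trans (mul_le_mul_of_nonneg_right h3 (by positivity)) h1
  have hupp : negD^[N] (theta t) φ ≤ C * (W t φ * (20 / (t * (t + (Real.pi - φ)))) ^ N) := by
    refine h2.trans ?_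
    rw [← mul_assoc]
    exact mul_le_mul_of_nonneg_right h4 (by positivity)
  have hK : 0 ≤ negD^[N] (theta t) φ := le_trans (by positivity) hlow
  rw [aux_W_eq N φ t hφ ht] at hlow hupp
  constructor
  · calc _ = (2 * Real.pi) ^ (-(N : ℝ)) * 1 * (c ^ N / Real.sqrt (4 * Real.pi) *
          ((t + Real.pi - φ) ^ (-(N : ℝ)) * t ^ (-(2 * (N : ℝ) + 1) / 2) *
            Real.exp (-φ ^ 2 / (4 * t)))) := by ring
      _ ≤ (2 * Real.pi) ^ (-(N : ℝ)) * 1 * negD^[N] (theta t) φ := by gcongr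
      _ ≤ _ := by
        gcongr
        exact Real.one_le_exp (by positivity)
  · calc _ ≤ (2 * Real.pi) ^ (-(N : ℝ)) * Real.exp (T * (N : ℝ) ^ 2) * negD^[N] (theta t) φ := by
          gcongr
      _ ≤ (2 * Real.pi) ^ (-(N : ℝ)) * Real.exp (T * (N : ℝ) ^ 2) *
          (C * (20 ^ N / Real.sqrt (4 * Real.pi) *
          ((t + Real.pi - φ) ^ (-(N : ℝ)) * t ^ (-(2 * (N : ℝ) + 1) / 2) *
            Real.exp (-φ ^ 2 / (4 * t))))) := by gcongr
      _ = _ := by ring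
end

section
/- Let N ∈ ℕ and T > 0 be fixed. Then there exist constants c, C > 0 (depending only on N and T) such that for all φ ∈ (0,π) and all t ≥ T: c·e^{-t(2N+1)}·φ(π−φ) ≤ (2π)^{-N} e^{tN²}·sin φ·((−D)^{N+1} θ_t)(φ) ≤ C·e^{-t(2N+1)}·φ(π−φ). (The middle expression equals −∂_φ K_t^{2N+1}(φ), the negative derivative of the heat kernel of S^{2N+1} in geodesic distance.) -/
open Polynomial Filter Topology

/-- q-Pochhammer `(q^2;q^2)_n`. -/
noncomputable def qP (q : ℝ) (n : ℕ) : ℝ := ∏ i ∈ Finset.range n, (1 - (q ^ 2) ^ (i + 1))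

noncomputable def gI (q : ℝ) (n : ℤ) : ℝ := if n < 0 then 0 else (qP q n.toNat)⁻¹

noncomputable def cf (q : ℝ) (m : ℕ) (k : ℤ) : ℝ :=
  q ^ (k ^ 2) * (qP q (2 * m) * gI q (m + k) * gI q (m - k))

noncomputable def Pm (q : ℝ) (m : ℕ) : ℝ[X] :=
  ∏ i ∈ Finset.range m, (C (1 + q ^ (4 * i + 2)) + C (2 * q ^ (2 * i + 1)) * X)

theorem prod_lower (r r0 : ℝ) (h0 : 0 ≤ r) (h : r ≤ r0) (h1 : r0 < 1) (n : ℕ) :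
    Real.exp (-(1 / (1 - r0) ^ 2)) ≤ ∏ i ∈ Finset.range n, (1 - r ^ (i + 1)) := by
  have hr0 : 0 ≤ r0 := h0.trans h
  have key : ∀ i : ℕ, Real.exp (-(r0 ^ i / (1 - r0))) ≤ 1 - r ^ (i + 1) := by
    intro i
    have hle : r ^ (i + 1) ≤ r0 ^ (i + 1) := by gcongr
    have hle2 : r0 ^ (i + 1) ≤ r0 ^ i := pow_le_pow_of_le_one hr0 h1.le (by omega)
    have hle3 : r0 ^ (i + 1) ≤ r0 := by
      simpa using pow_le_pow_of_le_one hr0 h1.le (show 1 ≤ i + 1 by omega)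
    have hd : 0 < 1 - r0 := by linarith
    set x := r0 ^ (i + 1) with hx
    have hx0 : 0 ≤ x := by positivity
    have hpos : 0 < 1 - x := by linarith
    have : x / (1 - x) ≤ r0 ^ i / (1 - r0) := by
      apply div_le_div₀ (by positivity) hle2 hd (by linarith)
    have h2 : Real.exp (-(x / (1 - x))) ≤ 1 - x := by
      rw [Real.exp_neg]
      apply inv_le_of_inv_le₀ hpos
      have := Real.add_one_le_exp (x / (1 - x))
      refine le_trans (le_of_eq ?_) this
      field_simp
      ring
    calc _ ≤ Real.exp (-(x / (1 - x))) := by gcongr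
      _ ≤ 1 - x := h2
      _ ≤ _ := by linarith
  calc _ ≤ Real.exp (∑ i ∈ Finset.range n, -(r0 ^ i / (1 - r0))) := by
        gcongr
        rw [Finset.sum_neg_distrib, ← Finset.sum_div]
        have hd : 0 < 1 - r0 := by linarith
        have : ∑ i ∈ Finset.range n, r0 ^ i ≤ 1 / (1 - r0) := by
          have := Summable.sum_le_tsum (Finset.range n) (fun i _ => by positivity)
            (summable_geometric_of_lt_one hr0 h1)
          rwa [tsum_geometric_of_lt_one hr0 h1, ← one_div] at this
        have h2 : (∑ i ∈ Finset.range n, r0 ^ i) / (1 - r0) ≤ 1 / (1 - r0) / (1 - r0) := by gcongr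
        have h3 : 1 / (1 - r0) / (1 - r0) = 1 / (1 - r0) ^ 2 := by field_simp
        linarith
    _ = ∏ i ∈ Finset.range n, Real.exp (-(r0 ^ i / (1 - r0))) := Real.exp_sum _ _
    _ ≤ _ := Finset.prod_le_prod (fun i _ => (Real.exp_pos _).le) (fun i _ => key i)

theorem qP_pos (q : ℝ) (h0 : 0 < q) (h1 : q < 1) (n : ℕ) : 0 < qP q n := by
  refine Finset.prod_pos fun i _ => ?_
  have : (q ^ 2) ^ (i + 1) < 1 := pow_lt_one₀ (by positivity) (pow_lt_one₀ h0.le h1 (by simp)) (by simp)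
  linarith

theorem qP_le_one (q : ℝ) (h0 : 0 < q) (h1 : q < 1) (n : ℕ) : qP q n ≤ 1 := by
  refine Finset.prod_le_one (fun i _ => ?_) (fun i _ => ?_)
  · have : (q ^ 2) ^ (i + 1) ≤ 1 := pow_le_one₀ (by positivity) (pow_le_one₀ h0.le h1.le)
    linarith
  · have : 0 ≤ (q ^ 2) ^ (i + 1) := by positivity
    linarith

theorem gI_rec (q : ℝ) (h0 : 0 < q) (h1 : q < 1) (n : ℤ) :
    gI q (n - 1) = (1 - (q ^ 2) ^ n) * gI q n := by
  unfold gI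
  rcases lt_trichotomy n 0 with h | h | h
  · rw [if_pos h, if_pos (by omega)]; simp
  · subst h; simp
  · rw [if_neg (by omega), if_neg (by omega)]
    obtain ⟨m, rfl⟩ : ∃ m : ℕ, n = m + 1 := ⟨(n - 1).toNat, by omega⟩
    have e1 : ((m : ℤ) + 1 - 1).toNat = m := by omega
    have e2 : ((m : ℤ) + 1).toNat = m + 1 := by omega
    rw [e1, e2]
    have hp := qP_pos q h0 h1 m
    have hp' := qP_pos q h0 h1 (m + 1)
    have : qP q (m + 1) = qP q m * (1 - (q ^ 2) ^ (m + 1)) := by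
      unfold qP; rw [Finset.prod_range_succ]
    have e3 : (q ^ 2) ^ ((m : ℤ) + 1) = (q ^ 2) ^ (m + 1) := by
      rw [← zpow_natCast]; push_cast; rfl
    rw [e3]
    rw [this] at hp' ⊢
    have : 0 < 1 - (q ^ 2) ^ (m + 1) := (pos_iff_pos_of_mul_pos hp').mp hp
    field_simp

theorem cf_rec (q : ℝ) (h0 : 0 < q) (h1 : q < 1) (m : ℕ) (k : ℤ) :
    cf q (m + 1) k = (1 + q ^ (4 * m + 2)) * cf q m k +
      q ^ (2 * m + 1) * (cf q m (k - 1) + cf q m (k + 1)) := by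
  unfold cf
  have hq : q ≠ 0 := h0.ne'
  have hP : qP q (2 * (m + 1)) =
      qP q (2 * m) * (1 - (q ^ 2) ^ (2 * m + 1)) * (1 - (q ^ 2) ^ (2 * m + 2)) := by
    unfold qP
    rw [show 2 * (m + 1) = 2 * m + 1 + 1 by ring, Finset.prod_range_succ, Finset.prod_range_succ]
  have g1 : gI q (m + k) = (1 - (q ^ 2) ^ ((m : ℤ) + 1 + k)) * gI q ((m + 1 : ℕ) + k) := by
    rw [show (m : ℤ) + k = ((m + 1 : ℕ) + k) - 1 by push_cast; ring, gI_rec q h0 h1]; push_cast; rfl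
  have g2 : gI q (m - k) = (1 - (q ^ 2) ^ ((m : ℤ) + 1 - k)) * gI q ((m + 1 : ℕ) - k) := by
    rw [show (m : ℤ) - k = ((m + 1 : ℕ) - k) - 1 by push_cast; ring, gI_rec q h0 h1]; push_cast; rfl
  have g3 : gI q (m + (k - 1)) = (1 - (q ^ 2) ^ ((m : ℤ) + k)) * gI q (m + k) := by
    rw [show (m : ℤ) + (k - 1) = (m + k) - 1 by ring, gI_rec q h0 h1]
  have g4 : gI q (m - (k - 1)) = gI q ((m + 1 : ℕ) - k) := by
    congr 1; push_cast; ring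
  have g5 : gI q (m + (k + 1)) = gI q ((m + 1 : ℕ) + k) := by
    congr 1; push_cast; ring
  have g6 : gI q (m - (k + 1)) = (1 - (q ^ 2) ^ ((m : ℤ) - k)) * gI q (m - k) := by
    rw [show (m : ℤ) - (k + 1) = (m - k) - 1 by ring, gI_rec q h0 h1]
  rw [hP, g3, g4, g5, g6, g1, g2]
  generalize gI q ((m + 1 : ℕ) + k) = u
  generalize gI q ((m + 1 : ℕ) - k) = v
  generalize qP q (2 * m) = p
  have s1 : q ^ ((k - 1) ^ 2) = q ^ (k ^ 2) * (q ^ k)⁻¹ ^ 2 * q := by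
    rw [show (k - 1) ^ 2 = k ^ 2 + -k + -k + 1 by ring, zpow_add₀ hq, zpow_add₀ hq, zpow_add₀ hq,
      zpow_neg, zpow_one]; ring
  have s2 : q ^ ((k + 1) ^ 2) = q ^ (k ^ 2) * (q ^ k) ^ 2 * q := by
    rw [show (k + 1) ^ 2 = k ^ 2 + k + k + 1 by ring, zpow_add₀ hq, zpow_add₀ hq, zpow_add₀ hq,
      zpow_one]; ring
  have hq2 : q ^ 2 ≠ 0 := by positivity
  have hz : (q ^ 2) ^ k = (q ^ k) ^ 2 := by
    rw [← zpow_natCast, ← zpow_natCast, ← zpow_mul, ← zpow_mul, mul_comm]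
  rw [s1, s2]
  simp only [zpow_add₀ hq2, zpow_sub₀ hq2, zpow_natCast, zpow_one, hz]
  have hx : q ^ k ≠ 0 := by positivity
  generalize q ^ k = x at *
  generalize q ^ (k ^ 2) = y at *
  have : q ^ (4 * m + 2) = (q ^ m) ^ 4 * q ^ 2 := by ring
  have t2 : q ^ (2 * m + 1) = (q ^ m) ^ 2 * q := by ring
  have t3 : (q ^ 2) ^ m = (q ^ m) ^ 2 := by ring
  have t4 : (q ^ 2) ^ (2 * m + 1) = (q ^ m) ^ 4 * q ^ 2 := by ring
  have t5 : (q ^ 2) ^ (2 * m + 2) = (q ^ m) ^ 4 * q ^ 4 := by ring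
  rw [this, t2, t3, t4, t5]
  generalize q ^ m = z
  field_simp
  ring

theorem cf_zero_of (q : ℝ) (m : ℕ) (k : ℤ) (h : k ∉ Finset.Icc (-(m : ℤ)) m) : cf q m k = 0 := by
  unfold cf gI
  rw [Finset.mem_Icc] at h
  by_cases hk : (m : ℤ) + k < 0
  · rw [if_pos hk]; simp
  · rw [if_pos (show (m : ℤ) - k < 0 by omega)]; simp

theorem cf_fin (q : ℝ) (m : ℕ) (d : ℤ) (f : ℤ → ℝ[X]) :
    (Function.support fun k => C (cf q m (k + d)) * f k).Finite := by
  refine (Finset.finite_toSet (Finset.Icc (-(m : ℤ) - d) (m - d))).subset ?_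
  intro k hk
  by_contra h
  apply hk
  have : cf q m (k + d) = 0 := by
    apply cf_zero_of
    simp only [Finset.coe_Icc, Set.mem_Icc, Finset.mem_Icc] at h ⊢
    omega
  simp [this]

theorem Pm_eq (q : ℝ) (h0 : 0 < q) (h1 : q < 1) (m : ℕ) :
    Pm q m = ∑ᶠ k : ℤ, C (cf q m k) * Chebyshev.T ℝ k := by
  induction m with
  | zero =>
    rw [finsum_eq_single _ 0]
    · simp [Pm, cf, gI, qP]
    · intro k hk
      rw [cf_zero_of q 0 k (by simpa using hk)]; simp
  | succ m ih =>
    have hs : Pm q (m + 1) = (C (1 + q ^ (4 * m + 2)) + C (2 * q ^ (2 * m + 1)) * X) * Pm q m := by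
      unfold Pm; rw [Finset.prod_range_succ, mul_comm]
    have f0 : ∀ f : ℤ → ℝ[X], (Function.support fun k => C (cf q m k) * f k).Finite := by
      intro f; simpa using cf_fin q m 0 f
    have e1 : ∑ᶠ k : ℤ, C (cf q m (k - 1)) * Chebyshev.T ℝ k =
        ∑ᶠ k : ℤ, C (cf q m k) * Chebyshev.T ℝ (k + 1) := by
      rw [← finsum_comp_equiv (Equiv.addRight (1 : ℤ))]
      simp
    have e2 : ∑ᶠ k : ℤ, C (cf q m (k + 1)) * Chebyshev.T ℝ k =
        ∑ᶠ k : ℤ, C (cf q m k) * Chebyshev.T ℝ (k - 1) := by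
      rw [← finsum_comp_equiv (Equiv.addRight (-1 : ℤ))]
      simp [← sub_eq_add_neg]
    have r1 : ∑ᶠ k : ℤ, C (cf q (m + 1) k) * Chebyshev.T ℝ k =
        C (1 + q ^ (4 * m + 2)) * ∑ᶠ k : ℤ, C (cf q m k) * Chebyshev.T ℝ k +
        C (q ^ (2 * m + 1)) * (∑ᶠ k : ℤ, C (cf q m (k - 1)) * Chebyshev.T ℝ k +
          ∑ᶠ k : ℤ, C (cf q m (k + 1)) * Chebyshev.T ℝ k) := by
      have a1 := cf_fin q m (-1) (fun k => Chebyshev.T ℝ k)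
      have a2 := cf_fin q m 1 (fun k => Chebyshev.T ℝ k)
      simp only [← sub_eq_add_neg] at a1
      have a3 := (a1.union a2).subset (Function.support_add _ _)
      rw [← finsum_add_distrib a1 a2, mul_finsum' _ _ (f0 _), mul_finsum' _ _ a3, ← finsum_add_distrib]
      · apply finsum_congr
        intro k
        rw [cf_rec q h0 h1]
        simp only [C_add, C_mul]
        ring
      · refine (f0 (Chebyshev.T ℝ)).subset ?_
        intro k hk hk'
        apply hk
        simp only at hk' ⊢
        rw [hk']; simp
      · refine Set.Finite.subset a3 ?_
        intro k hk hk'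
        apply hk
        simp only at hk' ⊢
        rw [hk']; simp
    rw [hs, ih, r1, e1, e2, ← finsum_add_distrib (f0 _) (f0 _), add_mul]
    congr 1
    rw [mul_finsum' _ _ (f0 _), mul_finsum']
    · apply finsum_congr
      intro k
      rw [Chebyshev.T_add_one]
      simp only [C_mul]
      have : (C (2:ℝ) : ℝ[X]) = 2 := rfl
      rw [this]
      ring
    · exact ((f0 _).union (f0 _)).subset (Function.support_add _ _)

/-- derivatives of the finite product as a sum -/
theorem Pm_deriv (q : ℝ) (h0 : 0 < q) (h1 : q < 1) (m j : ℕ) (x : ℝ) :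
    eval x (derivative^[j] (Pm q m)) =
      ∑' k : ℤ, cf q m k * eval x (derivative^[j] (Chebyshev.T ℝ k)) := by
  have f0 : (Function.support fun k => C (cf q m k) * Chebyshev.T ℝ k) ⊆ Finset.Icc (-(m : ℤ)) m := by
    intro k hk
    by_contra h
    apply hk
    simp only
    rw [cf_zero_of q m k h]; simp
  rw [Pm_eq q h0 h1, finsum_eq_sum_of_support_subset _ f0, tsum_eq_sum (s := Finset.Icc (-(m : ℤ)) m),
    iterate_derivative_sum, eval_finsetSum]
  · refine Finset.sum_congr rfl fun k _ => ?_
    rw [iterate_derivative_C_mul]; simp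
  · intro k hk
    rw [cf_zero_of q m k hk]; simp

theorem eval_iter_lin (a b x : ℝ) (j : ℕ) (p : ℝ[X]) :
    eval x (derivative^[j] ((C a + C b * X) * p)) =
      (a + b * x) * eval x (derivative^[j] p) + j * b * eval x (derivative^[j - 1] p) := by
  have : (C a + C b * X) * p = C a * p + C b * (p * X) := by ring
  rw [this, iterate_map_add, iterate_derivative_C_mul, iterate_derivative_C_mul,
    iterate_derivative_mul_X]
  simp
  ring

theorem Pm_succ (q : ℝ) (m : ℕ) :
    Pm q (m + 1) = (C (1 + q ^ (4 * m + 2)) + C (2 * q ^ (2 * m + 1)) * X) * Pm q m := by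
  unfold Pm; rw [Finset.prod_range_succ, mul_comm]

theorem lin_lower (q x : ℝ) (h0 : 0 < q) (hx : -1 ≤ x) (m : ℕ) :
    (1 - q ^ (2 * m + 1)) ^ 2 ≤ 1 + q ^ (4 * m + 2) + 2 * q ^ (2 * m + 1) * x := by
  have e : q ^ (4 * m + 2) = (q ^ (2 * m + 1)) ^ 2 := by ring
  rw [e]
  have : 0 < q ^ (2 * m + 1) := by positivity
  nlinarith

theorem Pm_nonneg (q x : ℝ) (h0 : 0 < q) (hx : -1 ≤ x) (m : ℕ) :
    ∀ j, 0 ≤ eval x (derivative^[j] (Pm q m)) := by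
  induction m with
  | zero =>
    intro j
    rcases j with _ | j
    · simp [Pm]
    · simp [Pm, iterate_derivative_one]
  | succ m ih =>
    intro j
    rw [Pm_succ, eval_iter_lin]
    have := (sq_nonneg _).trans (lin_lower q x h0 hx m)
    have h1 := ih j
    have h2 := ih (j - 1)
    positivity

theorem Pm_diag (q x : ℝ) (h0 : 0 < q) (hx : -1 ≤ x) (j : ℕ) :
    q ^ (j ^ 2) ≤ eval x (derivative^[j] (Pm q j)) := by
  induction j with
  | zero => simp [Pm]
  | succ j ih =>
    rw [Pm_succ, eval_iter_lin]
    have := (sq_nonneg _).trans (lin_lower q x h0 hx j)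
    have h1 := Pm_nonneg q x h0 hx j (j + 1)
    have h2 := mul_nonneg this h1
    have e : q ^ ((j + 1) ^ 2) = q ^ (2 * j + 1) * q ^ (j ^ 2) := by rw [← pow_add]; ring_nf
    have h3 : q ^ (2 * j + 1) * q ^ (j ^ 2) ≤
        q ^ (2 * j + 1) * eval x (derivative^[j] (Pm q j)) := by gcongr
    have h4 := mul_nonneg (show 0 ≤ (2 * (j : ℝ) + 1) * q ^ (2 * j + 1) by positivity)
      (Pm_nonneg q x h0 hx j j)
    rw [e]
    simp only [Nat.add_sub_cancel]
    push_cast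
    nlinarith

theorem Pm_lower (q x : ℝ) (h0 : 0 < q) (h1 : q < 1) (hx : -1 ≤ x) (j m : ℕ) :
    q ^ (j ^ 2) * (∏ i ∈ Finset.range m, (1 - q ^ (i + 1))) ^ 2 ≤
      eval x (derivative^[j] (Pm q (j + m))) := by
  induction m with
  | zero => simpa using Pm_diag q x h0 hx j
  | succ m ih =>
    rw [← add_assoc, Pm_succ, eval_iter_lin]
    have a1 := lin_lower q x h0 hx (j + m)
    have a2 := Pm_nonneg q x h0 hx (j + m) (j - 1)
    have a3 := Pm_nonneg q x h0 hx (j + m) j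
    have a4 : 0 ≤ j * (2 * q ^ (2 * (j + m) + 1)) * eval x (derivative^[j - 1] (Pm q (j + m))) := by
      positivity
    have a5 : q ^ (2 * (j + m) + 1) ≤ q ^ (m + 1) := pow_le_pow_of_le_one h0.le h1.le (by omega)
    have a6 : q ^ (m + 1) ≤ 1 := pow_le_one₀ h0.le h1.le
    have a7 : (1 - q ^ (m + 1)) ^ 2 ≤ (1 - q ^ (2 * (j + m) + 1)) ^ 2 := by
      gcongr
    rw [Finset.prod_range_succ, mul_pow]
    calc _ = (1 - q ^ (m + 1)) ^ 2 * (q ^ (j ^ 2) * (∏ i ∈ Finset.range m, (1 - q ^ (i + 1))) ^ 2) := by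
          ring
      _ ≤ (1 + q ^ (4 * (j + m) + 2) + 2 * q ^ (2 * (j + m) + 1) * x) *
            eval x (derivative^[j] (Pm q (j + m))) := by
          apply mul_le_mul (a7.trans a1) ih (by positivity) ((sq_nonneg _).trans a1)
      _ ≤ _ := by linarith

theorem cheb_bound_nat (J : ℕ) (x : ℝ) (hx : |x| ≤ 1) (n : ℕ) : ∀ j ≤ J,
    |eval x (derivative^[j] (Chebyshev.T ℝ (n : ℤ)))| ≤ (2 * (J : ℝ) + 3) ^ n := by
  induction n using Nat.strong_induction_on with
  | _ n ih =>
  intro j hj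
  rcases n with _ | _ | n
  · rcases j with _ | j
    · simp
    · simp [iterate_derivative_one]
  · rcases j with _ | _ | j
    · simp; linarith [(Nat.cast_nonneg J : (0 : ℝ) ≤ J)]
    · simp; linarith [(Nat.cast_nonneg J : (0 : ℝ) ≤ J)]
    · rw [iterate_derivative_eq_zero]
      · simp; positivity
      · simp
  · have e : Chebyshev.T ℝ ((n + 1 + 1 : ℕ) : ℤ) =
        (C 0 + C 2 * X) * Chebyshev.T ℝ ((n + 1 : ℕ) : ℤ) - Chebyshev.T ℝ (n : ℤ) := by
      have := Chebyshev.T_add_two ℝ (n : ℤ)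
      push_cast
      rw [add_assoc, one_add_one_eq_two, this]
      have : (C (2:ℝ) : ℝ[X]) = 2 := rfl
      rw [this]; simp
    rw [e, iterate_derivative_sub, eval_sub, eval_iter_lin]
    have b1 := ih (n + 1) (by omega) j hj
    have b2 := ih (n + 1) (by omega) (j - 1) (by omega)
    have b3 := ih n (by omega) j hj
    have hM : (1 : ℝ) ≤ 2 * J + 3 := by linarith [(Nat.cast_nonneg J : (0 : ℝ) ≤ J)]
    have b4 : (2 * (J : ℝ) + 3) ^ n ≤ (2 * (J : ℝ) + 3) ^ (n + 1) :=
      pow_le_pow_right₀ hM (by omega)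
    set A := eval x (derivative^[j] (Chebyshev.T ℝ ((n + 1 : ℕ) : ℤ)))
    set B := eval x (derivative^[j - 1] (Chebyshev.T ℝ ((n + 1 : ℕ) : ℤ)))
    set D := eval x (derivative^[j] (Chebyshev.T ℝ (n : ℤ)))
    have hjJ : (j : ℝ) ≤ J := by exact_mod_cast hj
    have c1 : |x * A| ≤ (2 * (J : ℝ) + 3) ^ (n + 1) := by
      rw [abs_mul]
      calc _ ≤ 1 * |A| := by gcongr
        _ ≤ _ := by linarith
    have c2 : |j * B| ≤ J * (2 * (J : ℝ) + 3) ^ (n + 1) := by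
      rw [abs_mul, Nat.abs_cast]
      gcongr
    have e2 : (2 * (J : ℝ) + 3) ^ (n + 1 + 1) = 2 * (2 * (J : ℝ) + 3) ^ (n + 1) +
        2 * (J * (2 * (J : ℝ) + 3) ^ (n + 1)) + (2 * (J : ℝ) + 3) ^ (n + 1) := by ring
    rw [e2]
    rw [abs_le] at c1 c2 b3 ⊢
    constructor <;> nlinarith

theorem cheb_bound (j : ℕ) (x : ℝ) (hx : |x| ≤ 1) (k : ℤ) :
    |eval x (derivative^[j] (Chebyshev.T ℝ k))| ≤ (2 * (j : ℝ) + 3) ^ k.natAbs := by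
  rw [← Chebyshev.T_natAbs]
  exact cheb_bound_nat j x hx k.natAbs j le_rfl

theorem summable_u (q M : ℝ) (h0 : 0 < q) (h1 : q < 1) (hM : 0 < M) :
    Summable fun k : ℤ => q ^ (k ^ 2) * M ^ k.natAbs := by
  have hl : 0 < -Real.log q := by linarith [Real.log_neg h0 h1]
  have := summable_pow_mul_jacobiTheta₂_term_bound (Real.log M / (2 * Real.pi))
    (T := -Real.log q / Real.pi) (by positivity) 0
  refine this.congr fun k => ?_
  have e1 : q ^ (k ^ 2) = Real.exp (Real.log q * k ^ 2) := by
    rw [← Real.rpow_intCast, Real.rpow_def_of_pos h0]; push_cast; rfl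
  have e2 : M ^ k.natAbs = Real.exp (Real.log M * |(k : ℝ)|) := by
    rw [← Real.rpow_natCast, Real.rpow_def_of_pos hM, Nat.cast_natAbs]; push_cast; rfl
  rw [e1, e2, ← Real.exp_add, pow_zero, one_mul]
  congr 1
  field_simp
  push_cast
  ring

noncomputable def SS (q : ℝ) (j : ℕ) (x : ℝ) : ℝ :=
  ∑' k : ℤ, q ^ (k ^ 2) * eval x (derivative^[j] (Chebyshev.T ℝ k))

theorem SS_upper (j : ℕ) (r : ℝ) (hr0 : 0 < r) (hr1 : r < 1) : ∃ K : ℝ, 0 < K ∧ ∀ q x : ℝ,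
    0 < q → q ≤ r → |x| ≤ 1 → SS q j x ≤ K * q ^ (j ^ 2) := by
  set M : ℝ := 2 * (j : ℝ) + 3 with hM
  have hMpos : 0 < M := by positivity
  have hs := summable_u r M hr0 hr1 hMpos
  have hpos : ∀ k : ℤ, 0 < r ^ (k ^ 2) * M ^ k.natAbs := fun k => by positivity
  refine ⟨(∑' k : ℤ, r ^ (k ^ 2) * M ^ k.natAbs) / r ^ (j ^ 2), ?_, ?_⟩
  · exact div_pos (hs.tsum_pos (fun k => (hpos k).le) 0 (hpos 0)) (by positivity)
  · intro q x hq hqr hx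
    have hb : ∀ k : ℤ, q ^ (k ^ 2) * eval x (derivative^[j] (Chebyshev.T ℝ k)) ≤
        q ^ (j ^ 2) / r ^ (j ^ 2) * (r ^ (k ^ 2) * M ^ k.natAbs) := by
      intro k
      by_cases hk : k.natAbs < j
      · rw [iterate_derivative_eq_zero (by rwa [Chebyshev.natDegree_T])]
        simp; positivity
      · push Not at hk
        obtain ⟨d, hd⟩ : ∃ d : ℕ, k ^ 2 = ((j ^ 2 + d : ℕ) : ℤ) := by
          obtain ⟨d, hd⟩ := Nat.exists_eq_add_of_le (Nat.pow_le_pow_left hk 2)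
          exact ⟨d, by rw [← hd]; push_cast; rw [sq_abs]⟩
        rw [hd, zpow_natCast, zpow_natCast, pow_add, pow_add]
        calc _ ≤ q ^ j ^ 2 * q ^ d * M ^ k.natAbs := by
              gcongr; exact (le_abs_self _).trans (cheb_bound j x hx k)
          _ ≤ q ^ j ^ 2 * r ^ d * M ^ k.natAbs := by gcongr
          _ = _ := by field_simp
    calc SS q j x ≤ ∑' k : ℤ, q ^ (j ^ 2) / r ^ (j ^ 2) * (r ^ (k ^ 2) * M ^ k.natAbs) := by
          refine Summable.tsum_le_tsum hb ?_ (hs.mul_left _)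
          refine (summable_u q M hq (hqr.trans_lt hr1) hMpos).of_norm_bounded fun k => ?_
          rw [norm_mul, Real.norm_of_nonneg (by positivity)]
          gcongr
          exact cheb_bound j x hx k
      _ = _ := by rw [tsum_mul_left]; ring

theorem SS_lower (j : ℕ) (r : ℝ) (hr0 : 0 < r) (hr1 : r < 1) : ∃ K : ℝ, 0 < K ∧ ∀ q x : ℝ,
    0 < q → q ≤ r → |x| ≤ 1 → K * q ^ (j ^ 2) ≤ SS q j x := by
  set Λ : ℝ := Real.exp (-(1 / (1 - r ^ 2) ^ 2)) with hΛ
  set Λ' : ℝ := Real.exp (-(1 / (1 - r) ^ 2)) with hΛ'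
  have hΛpos : 0 < Λ := Real.exp_pos _
  have hΛ'pos : 0 < Λ' := Real.exp_pos _
  refine ⟨Λ * Λ' ^ 2, by positivity, ?_⟩
  intro q x hq hqr hx
  have hq1 : q < 1 := hqr.trans_lt hr1
  set M : ℝ := 2 * (j : ℝ) + 3 with hM
  have hMpos : 0 < M := by positivity
  have hs := summable_u q M hq hq1 hMpos
  have hlow : ∀ n, Λ ≤ qP q n := fun n =>
    prod_lower (q ^ 2) (r ^ 2) (by positivity) (by gcongr) (pow_lt_one₀ hr0.le hr1 (by simp)) n
  have hanti : Antitone (qP q) := by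
    refine antitone_nat_of_succ_le fun n => ?_
    have e : qP q (n + 1) = qP q n * (1 - (q ^ 2) ^ (n + 1)) := by
      unfold qP; rw [Finset.prod_range_succ]
    rw [e]
    have := qP_pos q hq hq1 n
    have : 0 < (q ^ 2) ^ (n + 1) := by positivity
    nlinarith
  obtain ⟨L, hL⟩ : ∃ L, Tendsto (qP q) atTop (𝓝 L) :=
    ⟨_, tendsto_atTop_ciInf hanti ⟨Λ, by rintro _ ⟨n, rfl⟩; exact hlow n⟩⟩
  have hLΛ : Λ ≤ L := ge_of_tendsto' hL hlow
  have hLpos : 0 < L := hΛpos.trans_le hLΛ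
  have hg0 : ∀ n, 0 ≤ gI q n := by
    intro n; unfold gI; split_ifs
    · exact le_rfl
    · exact (inv_pos.mpr (qP_pos q hq hq1 _)).le
  have hg1 : ∀ n, gI q n ≤ Λ⁻¹ := by
    intro n; unfold gI; split_ifs
    · positivity
    · exact inv_anti₀ hΛpos (hlow _)
  have hglim : ∀ d : ℤ, Tendsto (fun m : ℕ => gI q (m + d)) atTop (𝓝 L⁻¹) := by
    intro d
    have h1 : Tendsto (fun m : ℕ => ((m : ℤ) + d).toNat) atTop atTop := by
      refine tendsto_atTop_mono (f := fun m : ℕ => m - d.natAbs) (fun m => by omega) ?_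
      exact tendsto_sub_atTop_nat _
    have h2 := (hL.comp h1).inv₀ hLpos.ne'
    refine h2.congr' ?_
    filter_upwards [eventually_ge_atTop d.natAbs] with m hm
    unfold gI
    rw [if_neg (by omega)]
    rfl
  have hP2 : Tendsto (fun m : ℕ => qP q (2 * m)) atTop (𝓝 L) :=
    hL.comp (tendsto_id.const_mul_atTop' (by norm_num : 0 < 2))
  have hlim : Tendsto (fun m : ℕ => ∑' k : ℤ, cf q m k * eval x (derivative^[j] (Chebyshev.T ℝ k)))
      atTop (𝓝 (∑' k : ℤ, (q ^ (k ^ 2) * (L * L⁻¹ * L⁻¹)) *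
        eval x (derivative^[j] (Chebyshev.T ℝ k)))) := by
    refine tendsto_tsum_of_dominated_convergence
      (bound := fun k : ℤ => Λ⁻¹ * Λ⁻¹ * (q ^ (k ^ 2) * M ^ k.natAbs)) (hs.mul_left _) ?_ ?_
    · intro k
      refine Tendsto.mul_const _ (Tendsto.const_mul _ ?_)
      refine (hP2.mul (hglim k)).mul ?_
      simpa [sub_eq_add_neg] using hglim (-k)
    · refine Eventually.of_forall fun m k => ?_
      have c1 := hg0 (m + k)
      have c2 := hg0 (m - k)
      have c3 := qP_pos q hq hq1 (2 * m)
      have c4 := qP_le_one q hq hq1 (2 * m)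
      have c5 := hg1 (m + k)
      have c6 := hg1 (m - k)
      have c7 : 0 ≤ cf q m k := by unfold cf; positivity
      rw [norm_mul, Real.norm_of_nonneg c7]
      calc _ ≤ cf q m k * M ^ k.natAbs := by
            gcongr; exact cheb_bound j x hx k
        _ ≤ q ^ (k ^ 2) * (1 * Λ⁻¹ * Λ⁻¹) * M ^ k.natAbs := by
            unfold cf; gcongr
        _ = _ := by ring
  have hx' : -1 ≤ x := (abs_le.mp hx).1
  have hge : q ^ (j ^ 2) * Λ' ^ 2 ≤ ∑' k : ℤ, (q ^ (k ^ 2) * (L * L⁻¹ * L⁻¹)) *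
        eval x (derivative^[j] (Chebyshev.T ℝ k)) := by
    refine ge_of_tendsto hlim ?_
    filter_upwards [eventually_ge_atTop j] with m hm
    obtain ⟨d, rfl⟩ := Nat.exists_eq_add_of_le hm
    rw [← Pm_deriv q hq hq1]
    refine le_trans ?_ (Pm_lower q x hq hq1 hx' j d)
    gcongr
    exact prod_lower q r hq.le hqr hr1 d
  have he : ∑' k : ℤ, (q ^ (k ^ 2) * (L * L⁻¹ * L⁻¹)) *
        eval x (derivative^[j] (Chebyshev.T ℝ k)) = L⁻¹ * SS q j x := by
    unfold SS
    rw [← tsum_mul_left]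
    refine tsum_congr fun k => ?_
    field_simp
  rw [he] at hge
  calc Λ * Λ' ^ 2 * q ^ (j ^ 2) ≤ L * (q ^ (j ^ 2) * Λ' ^ 2) := by
        rw [mul_assoc, mul_comm (Λ' ^ 2)]; gcongr
    _ ≤ L * (L⁻¹ * SS q j x) := by gcongr
    _ = _ := by field_simp

theorem SS_deriv (q : ℝ) (h0 : 0 < q) (h1 : q < 1) (j : ℕ) (φ : ℝ) :
    HasDerivAt (fun φ => SS q j (Real.cos φ)) (-(Real.sin φ) * SS q (j + 1) (Real.cos φ)) φ := by
  have hc : ∀ y, |Real.cos y| ≤ 1 := Real.abs_cos_le_one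
  have hs := summable_u q (2 * ((j + 1 : ℕ) : ℝ) + 3) h0 h1 (by positivity)
  have hs0 := summable_u q (2 * (j : ℝ) + 3) h0 h1 (by positivity)
  have := hasDerivAt_tsum (𝕜 := ℝ) (F := ℝ) (g := fun (k : ℤ) φ =>
      q ^ (k ^ 2) * eval (Real.cos φ) (derivative^[j] (Chebyshev.T ℝ k)))
    (g' := fun (k : ℤ) φ => q ^ (k ^ 2) *
      (eval (Real.cos φ) (derivative^[j + 1] (Chebyshev.T ℝ k)) * (-Real.sin φ)))
    (y₀ := 0) hs ?_ ?_ ?_ φ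
  · have e : -(Real.sin φ) * SS q (j + 1) (Real.cos φ) = ∑' k : ℤ, q ^ (k ^ 2) *
        (eval (Real.cos φ) (derivative^[j + 1] (Chebyshev.T ℝ k)) * (-Real.sin φ)) := by
      unfold SS
      rw [← tsum_mul_left]
      refine tsum_congr fun k => ?_
      ring
    rw [e]
    exact this
  · intro k y
    refine HasDerivAt.const_mul _ ?_
    have h := ((derivative^[j] (Chebyshev.T ℝ k)).hasDerivAt (Real.cos y)).comp y
      (Real.hasDerivAt_cos y)
    rw [Function.iterate_succ_apply']
    exact h
  · intro k y
    rw [norm_mul, norm_mul, Real.norm_of_nonneg (by positivity), norm_neg]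
    gcongr
    calc _ ≤ (2 * ((j + 1 : ℕ) : ℝ) + 3) ^ k.natAbs * 1 := by
          gcongr
          · exact cheb_bound (j + 1) _ (hc y) k
          · exact Real.abs_sin_le_one y
      _ = _ := mul_one _
  · refine hs0.of_norm_bounded fun k => ?_
    rw [norm_mul, Real.norm_of_nonneg (by positivity)]
    gcongr
    exact cheb_bound j _ (hc 0) k

theorem theta_eq_s2 (t φ : ℝ) (ht : 0 < t) :
    theta t φ = 1 / (2 * Real.pi) * SS (Real.exp (-t)) 0 (Real.cos φ) := by
  have hpi := Real.pi_pos
  have h := Complex.tsum_exp_neg_quadratic (a := ((t / Real.pi : ℝ) : ℂ))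
    (by rw [Complex.ofReal_re]; positivity) (-Complex.I * ((φ / (2 * Real.pi) : ℝ) : ℂ))
  have hpiC : (Real.pi : ℂ) ≠ 0 := by exact_mod_cast hpi.ne'
  have htC : (t : ℂ) ≠ 0 := by exact_mod_cast ht.ne'
  have hR : ∀ n : ℤ, Complex.exp (-Real.pi / ((t / Real.pi : ℝ) : ℂ) *
      (n + Complex.I * (-Complex.I * ((φ / (2 * Real.pi) : ℝ) : ℂ))) ^ 2) =
      ((Real.exp (-(φ + 2 * Real.pi * n) ^ 2 / (4 * t)) : ℝ) : ℂ) := by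
    intro n
    rw [Complex.ofReal_exp]
    congr 1
    have : Complex.I * (-Complex.I * ((φ / (2 * Real.pi) : ℝ) : ℂ)) = ((φ / (2 * Real.pi) : ℝ) : ℂ) := by
      rw [← mul_assoc, mul_neg, Complex.I_mul_I]; simp
    rw [this]
    push_cast
    field_simp
    ring
  have hL : ∀ n : ℤ, Complex.exp (-Real.pi * ((t / Real.pi : ℝ) : ℂ) * n ^ 2 +
      2 * Real.pi * (-Complex.I * ((φ / (2 * Real.pi) : ℝ) : ℂ)) * n) =
      ((Real.exp (-t * n ^ 2) : ℝ) : ℂ) * Complex.exp ((-(n * φ) : ℝ) * Complex.I) := by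
    intro n
    rw [Complex.ofReal_exp, ← Complex.exp_add]
    congr 1
    push_cast
    field_simp
  simp_rw [hR, hL] at h
  have hq : ∀ n : ℤ, Real.exp (-t) ^ (n ^ 2) = Real.exp (-t * n ^ 2) := by
    intro n
    rw [← Real.rpow_intCast, ← Real.exp_mul]; push_cast; rfl
  have hsumm : Summable fun n : ℤ =>
      ((Real.exp (-t * n ^ 2) : ℝ) : ℂ) * Complex.exp ((-(n * φ) : ℝ) * Complex.I) := by
    refine (summable_u (Real.exp (-t)) 1 (Real.exp_pos _) (by simpa using ht) one_pos).of_norm_bounded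
      fun n => ?_
    rw [norm_mul, Complex.norm_exp_ofReal_mul_I, Complex.norm_real,
      Real.norm_of_nonneg (Real.exp_pos _).le, hq]
    simp
  have hre := congrArg Complex.re h
  rw [Complex.re_tsum hsumm, ← Complex.ofReal_tsum] at hre
  have hrt : ((t / Real.pi : ℝ) : ℂ) ^ (1 / 2 : ℂ) = ((Real.sqrt (t / Real.pi) : ℝ) : ℂ) := by
    rw [Real.sqrt_eq_rpow, Complex.ofReal_cpow (by positivity)]
    push_cast; rfl
  rw [hrt, ← Complex.ofReal_one, ← Complex.ofReal_div, ← Complex.ofReal_mul, Complex.ofReal_re] at hre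
  have hcos : ∀ n : ℤ, (((Real.exp (-t * n ^ 2) : ℝ) : ℂ) *
      Complex.exp ((-(n * φ) : ℝ) * Complex.I)).re =
      Real.exp (-t) ^ (n ^ 2) * eval (Real.cos φ) (derivative^[0] (Chebyshev.T ℝ n)) := by
    intro n
    rw [Complex.re_ofReal_mul, Complex.exp_ofReal_mul_I_re, Real.cos_neg, hq]
    simp
  simp_rw [hcos] at hre
  unfold SS
  rw [hre]
  unfold theta W
  rw [tsum_mul_left, ← mul_assoc]
  congr 1
  have hs1 : Real.sqrt (4 * Real.pi * t) = 2 * Real.pi * Real.sqrt (t / Real.pi) := by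
    rw [Real.sqrt_eq_iff_mul_self_eq (by positivity) (by positivity)]
    have : Real.sqrt (t / Real.pi) * Real.sqrt (t / Real.pi) = t / Real.pi :=
      Real.mul_self_sqrt (by positivity)
    have h2 : 4 * Real.pi * t =
        4 * Real.pi ^ 2 * (Real.sqrt (t / Real.pi) * Real.sqrt (t / Real.pi)) := by
      rw [this]; field_simp
    rw [h2]; ring
  rw [hs1]
  have : 0 < Real.sqrt (t / Real.pi) := by positivity
  field_simp

theorem negD_iter (t : ℝ) (ht : 0 < t) (j : ℕ) : ∀ φ ∈ Set.Ioo 0 Real.pi,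
    (negD^[j] (theta t)) φ = 1 / (2 * Real.pi) * SS (Real.exp (-t)) j (Real.cos φ) := by
  induction j with
  | zero => intro φ _; simpa using theta_eq_s2 t φ ht
  | succ j ih =>
    intro φ hφ
    rw [Function.iterate_succ_apply']
    unfold negD
    have he : (negD^[j] (theta t)) =ᶠ[𝓝 φ]
        fun φ => 1 / (2 * Real.pi) * SS (Real.exp (-t)) j (Real.cos φ) := by
      filter_upwards [Ioo_mem_nhds hφ.1 hφ.2] with y hy using ih y hy
    have hd := (SS_deriv (Real.exp (-t)) (Real.exp_pos _) (by simpa using ht) j φ).const_mul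
      (1 / (2 * Real.pi))
    have hsin := Real.sin_pos_of_pos_of_lt_pi hφ.1 hφ.2
    have := he.deriv_eq
    unfold negD at this
    rw [this, hd.deriv]
    field_simp

theorem sin_bounds (φ : ℝ) (hφ : φ ∈ Set.Ioo 0 Real.pi) :
    2 / Real.pi ^ 2 * (φ * (Real.pi - φ)) ≤ Real.sin φ ∧
      Real.sin φ ≤ 2 / Real.pi * (φ * (Real.pi - φ)) := by
  have key : ∀ ψ : ℝ, 0 < ψ → ψ ≤ Real.pi / 2 →
      2 / Real.pi ^ 2 * (ψ * (Real.pi - ψ)) ≤ Real.sin ψ ∧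
      Real.sin ψ ≤ 2 / Real.pi * (ψ * (Real.pi - ψ)) := by
    intro ψ h0 h1
    have hpi := Real.pi_pos
    have a1 := Real.mul_le_sin h0.le h1
    have a2 := Real.sin_le h0.le
    constructor
    · refine le_trans ?_ a1
      rw [div_mul_eq_mul_div, div_mul_eq_mul_div, div_le_div_iff₀ (by positivity) hpi]
      have : 0 < ψ * ψ * Real.pi := by positivity
      nlinarith
    · refine a2.trans ?_
      rw [div_mul_eq_mul_div, le_div_iff₀ hpi]
      nlinarith
  rcases le_total φ (Real.pi / 2) with h | h
  · exact key φ hφ.1 h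
  · have := key (Real.pi - φ) (by linarith [hφ.2]) (by linarith)
    rw [Real.sin_pi_sub, sub_sub_cancel, mul_comm (Real.pi - φ)] at this
    exact this

/-- Sharp two-sided estimate for `-d/dφ K_t^{2N+1}(φ)`, expressed through
`(2π)^{-N} e^{tN²} · sin φ · ((-D)^{N+1} θ_t)(φ)`, for `t ≥ T`. -/
theorem sphere_heat_kernel_derivative_sharp_estimate_large_time (N : ℕ) (T : ℝ) (hT : 0 < T) :
    ∃ c C : ℝ, 0 < c ∧ 0 < C ∧
      ∀ φ t : ℝ, φ ∈ Set.Ioo 0 Real.pi → T ≤ t →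
        c * Real.exp (-t * (2 * (N : ℝ) + 1)) * (φ * (Real.pi - φ)) ≤
          (2 * Real.pi) ^ (-(N : ℝ)) * Real.exp (t * (N : ℝ) ^ 2) * Real.sin φ *
            (negD^[N + 1] (theta t)) φ ∧
        (2 * Real.pi) ^ (-(N : ℝ)) * Real.exp (t * (N : ℝ) ^ 2) * Real.sin φ *
            (negD^[N + 1] (theta t)) φ ≤
          C * Real.exp (-t * (2 * (N : ℝ) + 1)) * (φ * (Real.pi - φ)) := by
  obtain ⟨K1, hK1, hl⟩ := SS_lower (N + 1) (Real.exp (-T)) (Real.exp_pos _) (by simpa using hT)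
  obtain ⟨K2, hK2, hu⟩ := SS_upper (N + 1) (Real.exp (-T)) (Real.exp_pos _) (by simpa using hT)
  have hpi := Real.pi_pos
  have hA : 0 < (2 * Real.pi) ^ (-(N : ℝ)) := by positivity
  set A := (2 * Real.pi) ^ (-(N : ℝ)) with hAdef
  refine ⟨A * (1 / (2 * Real.pi)) * K1 * (2 / Real.pi ^ 2), A * (1 / (2 * Real.pi)) * K2 * (2 / Real.pi),
    by positivity, by positivity, ?_⟩
  intro φ t hφ ht
  have ht0 : 0 < t := hT.trans_le ht
  have hqr : Real.exp (-t) ≤ Real.exp (-T) := by gcongr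
  have h1 := hl (Real.exp (-t)) (Real.cos φ) (Real.exp_pos _) hqr (Real.abs_cos_le_one φ)
  have h2 := hu (Real.exp (-t)) (Real.cos φ) (Real.exp_pos _) hqr (Real.abs_cos_le_one φ)
  obtain ⟨s1, s2⟩ := sin_bounds φ hφ
  have hsin := Real.sin_pos_of_pos_of_lt_pi hφ.1 hφ.2
  have hφp : 0 < φ * (Real.pi - φ) := mul_pos hφ.1 (by linarith [hφ.2])
  rw [negD_iter t ht0 (N + 1) φ hφ]
  have hexp : Real.exp (-t * (2 * (N : ℝ) + 1)) =
      Real.exp (t * (N : ℝ) ^ 2) * Real.exp (-t) ^ ((N + 1) ^ 2) := by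
    rw [← Real.exp_nat_mul, ← Real.exp_add]
    congr 1
    push_cast
    ring
  rw [hexp]
  set S := SS (Real.exp (-t)) (N + 1) (Real.cos φ)
  set Q := Real.exp (-t) ^ ((N + 1) ^ 2)
  have hQ : 0 < Q := by positivity
  set E := Real.exp (t * (N : ℝ) ^ 2)
  have hE : 0 < E := Real.exp_pos _
  have hS : 0 < S := lt_of_lt_of_le (by positivity) h1
  constructor
  · calc _ = A * E * (2 / Real.pi ^ 2 * (φ * (Real.pi - φ))) * (1 / (2 * Real.pi) * (K1 * Q)) := by ring
      _ ≤ _ := by gcongr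
  · calc _ ≤ A * E * (2 / Real.pi * (φ * (Real.pi - φ))) * (1 / (2 * Real.pi) * (K2 * Q)) := by gcongr
      _ = _ := by ring
end

section
/- Let N ∈ ℕ be fixed. There exist t₀ > 0 and constants c, C > 0 such that for all φ ∈ (0,π) and 0 < t ≤ t₀: c·W_t(φ)·(t+π−φ)^{-N}·t^{-N} ≤ ((−D)^N θ_t)(φ) ≤ C·W_t(φ)·(t+π−φ)^{-N}·t^{-N}. -/
open Filter Topology

noncomputable def Qp (Q : ℝ) (k : ℕ) : ℝ := ∏ i ∈ Finset.range k, (1 - Q ^ (i + 1))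

noncomputable def rr (Q : ℝ) (k : ℤ) : ℝ := if k < 0 then 0 else (Qp Q k.toNat)⁻¹

lemma Qp_pos {Q : ℝ} (h0 : 0 < Q) (h1 : Q < 1) (k : ℕ) : 0 < Qp Q k :=
  Finset.prod_pos fun i _ => sub_pos.2 (pow_lt_one₀ h0.le h1 (Nat.succ_ne_zero i))

lemma Qp_le_one {Q : ℝ} (h0 : 0 < Q) (h1 : Q < 1) (k : ℕ) : Qp Q k ≤ 1 :=
  Finset.prod_le_one (fun i _ => (sub_pos.2 (pow_lt_one₀ h0.le h1 (Nat.succ_ne_zero i))).le)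
    (fun i _ => by have := pow_pos h0 (i + 1); linarith)

lemma Qp_succ (Q : ℝ) (k : ℕ) : Qp Q (k + 1) = Qp Q k * (1 - Q ^ (k + 1)) := by
  simp [Qp, Finset.prod_range_succ]

lemma Qp_anti {Q : ℝ} (h0 : 0 < Q) (h1 : Q < 1) : Antitone (Qp Q) := by
  refine antitone_nat_of_succ_le fun n => ?_
  rw [Qp_succ]
  have := Qp_pos h0 h1 n
  have h2 := pow_pos h0 (n + 1)
  nlinarith

lemma Qp_lim {Q : ℝ} (h0 : 0 < Q) (h1 : Q < 1) :
    ∃ L, 0 < L ∧ Tendsto (Qp Q) atTop (𝓝 L) ∧ ∀ k, L ≤ Qp Q k := by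
  have hs : Summable (fun n : ℕ => ‖-Q ^ (n + 1)‖) := by
    simpa [abs_of_pos h0] using
      (summable_nat_add_iff 1).mpr (summable_geometric_of_lt_one h0.le h1)
  have hm := multipliable_one_add_of_summable hs
  have ht := hm.hasProd.tendsto_prod_nat
  have hne := tprod_one_add_ne_zero_of_summable (f := fun n : ℕ => -Q ^ (n + 1)) (fun i => by
    have := pow_lt_one₀ h0.le h1 (Nat.succ_ne_zero i)
    simp only [Nat.succ_eq_add_one] at this
    intro h; linarith) hs
  have ht' : Tendsto (Qp Q) atTop (𝓝 (∏' n : ℕ, (1 + -Q ^ (n + 1)))) := by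
    refine ht.congr fun n => ?_
    simp [Qp, sub_eq_add_neg]
  refine ⟨_, lt_of_le_of_ne (ge_of_tendsto' ht' fun k => (Qp_pos h0 h1 k).le) hne.symm, ht', ?_⟩
  exact fun k => (Qp_anti h0 h1).le_of_tendsto ht' k

lemma rr_rec {Q : ℝ} (h0 : 0 < Q) (h1 : Q < 1) (k : ℤ) :
    rr Q (k - 1) = (1 - Q ^ k) * rr Q k := by
  rcases lt_trichotomy k 0 with h | h | h
  · simp [rr, h, show k < 1 by omega]
  · subst h; simp [rr]
  · obtain ⟨n, rfl⟩ : ∃ n : ℕ, k = n + 1 := ⟨(k - 1).toNat, by omega⟩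
    have e : ((n : ℤ) + 1).toNat = n + 1 := by omega
    have h3 : ¬ ((n : ℤ) + 1 < 0) := by omega
    have := (Qp_pos h0 h1 n).ne'
    have h4 : (1 - Q ^ (n + 1)) ≠ 0 := (sub_pos.2 (pow_lt_one₀ h0.le h1 (Nat.succ_ne_zero n))).ne'
    have h5 : Q ^ ((n : ℤ) + 1) = Q ^ (n + 1) := by exact_mod_cast zpow_natCast Q (n + 1)
    simp only [rr, h3, e, Qp_succ, h5, if_false, add_sub_cancel_right, Int.toNat_natCast]
    rw [if_neg (by omega)]
    field_simp

lemma rr_nonneg {Q : ℝ} (h0 : 0 < Q) (h1 : Q < 1) (k : ℤ) : 0 ≤ rr Q k := by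
  unfold rr; split_ifs
  · exact le_rfl
  · exact (inv_pos.2 (Qp_pos h0 h1 _)).le

lemma rr_le {Q L : ℝ} (hL : 0 < L) (h : ∀ k, L ≤ Qp Q k) (k : ℤ) : rr Q k ≤ L⁻¹ := by
  unfold rr; split_ifs
  · positivity
  · exact inv_anti₀ hL (h _)

noncomputable def cc (q : ℝ) (m : ℕ) (j : ℤ) : ℝ :=
  q ^ (j ^ 2) * Qp (q ^ 2) (2 * m) * rr (q ^ 2) (m + j) * rr (q ^ 2) (m - j)

lemma cc_rec {q : ℝ} (h0 : 0 < q) (h1 : q < 1) (m : ℕ) (j : ℤ) :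
    cc q (m + 1) j = cc q m j * (1 + q ^ (4 * m + 2)) +
      q ^ (2 * m + 1) * (cc q m (j - 1) + cc q m (j + 1)) := by
  have hQ0 : 0 < q ^ 2 := by positivity
  have hQ1 : q ^ 2 < 1 := pow_lt_one₀ h0.le h1 two_ne_zero
  set Q := q ^ 2 with hQ
  set A : ℤ := m + 1 + j with hA
  set B : ℤ := m + 1 - j with hB
  have a1 := rr_rec hQ0 hQ1 A
  have a2 := rr_rec hQ0 hQ1 (A - 1)
  have b1 := rr_rec hQ0 hQ1 B
  have b2 := rr_rec hQ0 hQ1 (B - 1)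
  rw [zpow_sub_one₀ hQ0.ne'] at a2 b2
  rw [a1] at a2
  rw [b1] at b2
  have eab : Q ^ A * Q ^ B = Q ^ (2 * m + 2) := by
    rw [← zpow_add₀ hQ0.ne', ← zpow_natCast]; congr 1; push_cast; omega
  have e1 : q ^ (2 * m + 1) * q ^ ((j - 1) ^ 2) = q ^ (j ^ 2) * Q ^ B := by
    rw [hQ, ← zpow_natCast, ← zpow_natCast q 2, ← zpow_mul, ← zpow_add₀ h0.ne', ← zpow_add₀ h0.ne']
    congr 1; push_cast; rw [hB]; ring
  have e2 : q ^ (2 * m + 1) * q ^ ((j + 1) ^ 2) = q ^ (j ^ 2) * Q ^ A := by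
    rw [hQ, ← zpow_natCast, ← zpow_natCast q 2, ← zpow_mul, ← zpow_add₀ h0.ne', ← zpow_add₀ h0.ne']
    congr 1; push_cast; rw [hA]; ring
  have e3 : q ^ (4 * m + 2) = Q ^ A * Q ^ B * Q⁻¹ := by
    rw [eab, hQ]; field_simp; ring
  have e4 : Q ^ (2 * m + 1) = Q ^ A * Q ^ B * Q⁻¹ := by
    rw [eab]; field_simp; ring
  have f1 : ((m + 1 : ℕ) : ℤ) + j = A := by push_cast; omega
  have f2 : ((m + 1 : ℕ) : ℤ) - j = B := by push_cast; omega
  have f3 : (m : ℤ) + j = A - 1 := by omega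
  have f4 : (m : ℤ) - j = B - 1 := by omega
  have f5 : (m : ℤ) + (j - 1) = A - 1 - 1 := by omega
  have f6 : (m : ℤ) - (j - 1) = B := by omega
  have f7 : (m : ℤ) + (j + 1) = A := by omega
  have f8 : (m : ℤ) - (j + 1) = B - 1 - 1 := by omega
  have g : Qp Q (2 * (m + 1)) = Qp Q (2 * m) * (1 - Q ^ A * Q ^ B * Q⁻¹) * (1 - Q ^ A * Q ^ B) := by
    rw [show 2 * (m + 1) = 2 * m + 1 + 1 by ring, Qp_succ, Qp_succ, e4, eab]
  unfold cc
  rw [← hQ, f1, f2, f3, f4, f5, f6, f7, f8, a2, b2, a1, b1, g, e3]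
  generalize q ^ (2 * m + 1) = w at *
  generalize q ^ ((j - 1) ^ 2) = w1 at *
  generalize q ^ ((j + 1) ^ 2) = w2 at *
  generalize q ^ (j ^ 2) = w0 at *
  generalize Q ^ A = a at *
  generalize Q ^ B = b at *
  generalize rr Q A = ra at *
  generalize rr Q B = rb at *
  generalize Qp Q (2 * m) = p at *
  generalize Q⁻¹ = v at *
  linear_combination (-(p * ((1 - a * v) * ((1 - a) * ra)) * rb)) * e1 -
    (p * ra * ((1 - b * v) * ((1 - b) * rb))) * e2

lemma cc_zero (q : ℝ) (j : ℤ) : cc q 0 j = if j = 0 then 1 else 0 := by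
  rcases lt_trichotomy j 0 with h | h | h
  · simp [cc, rr, h, h.ne]
  · subst h; simp [cc, rr, Qp]
  · simp [cc, rr, h, h.ne']

lemma finite_jtp {q : ℝ} (h0 : 0 < q) (h1 : q < 1) (z : ℂ) (hz : z ≠ 0) (m : ℕ) :
    HasSum (fun j : ℤ => (cc q m j : ℂ) * z ^ j)
      (∏ k ∈ Finset.range m, ((1 + (q : ℂ) ^ (2 * k + 1) * z) * (1 + (q : ℂ) ^ (2 * k + 1) * z⁻¹))) := by
  induction m with
  | zero =>
    convert! hasSum_single (f := fun j : ℤ => (cc q 0 j : ℂ) * z ^ j) 0 ?_ using 1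
    · simp [cc_zero]
    · intro j hj; simp [cc_zero, hj]
  | succ m ih =>
    rw [Finset.prod_range_succ]
    have s1 := (Equiv.subRight (1 : ℤ)).hasSum_iff.2 ih
    have s2 := (Equiv.addRight (1 : ℤ)).hasSum_iff.2 ih
    have := (ih.mul_left (1 + (q : ℂ) ^ (4 * m + 2))).add
      ((s1.mul_left ((q : ℂ) ^ (2 * m + 1) * z)).add (s2.mul_left ((q : ℂ) ^ (2 * m + 1) * z⁻¹)))
    convert! this using 1
    · ext j
      simp only [Function.comp, Equiv.subRight_apply, Equiv.coe_addRight]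
      rw [cc_rec h0 h1, zpow_sub_one₀ hz, zpow_add_one₀ hz]
      push_cast
      field_simp
    · set P := ∏ k ∈ Finset.range m, ((1 + (q : ℂ) ^ (2 * k + 1) * z) * (1 + (q : ℂ) ^ (2 * k + 1) * z⁻¹))
      have : (q : ℂ) ^ (4 * m + 2) = (q : ℂ) ^ (2 * m + 1) * (q : ℂ) ^ (2 * m + 1) := by ring
      rw [this]
      field_simp
      ring

lemma summable_gauss {q : ℝ} (h0 : 0 < q) (h1 : q < 1) : Summable (fun j : ℤ => q ^ (j ^ 2)) := by
  have key : Summable (fun n : ℕ => q ^ (((n : ℤ)) ^ 2)) := by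
    refine Summable.of_nonneg_of_le (fun n => by positivity) (fun n => ?_)
      (summable_geometric_of_lt_one h0.le h1)
    have : q ^ ((n : ℤ) ^ 2) = q ^ (n ^ 2) := by exact_mod_cast zpow_natCast q (n ^ 2)
    rw [this]
    exact pow_le_pow_of_le_one h0.le h1.le (by nlinarith)
  refine Summable.of_nat_of_neg key ?_
  simpa using key

lemma jtp {q : ℝ} (h0 : 0 < q) (h1 : q < 1) : ∃ L : ℝ, 0 < L ∧ ∀ z : ℂ, ‖z‖ = 1 →
    Tendsto (fun m : ℕ => ∏ k ∈ Finset.range m,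
      ((1 + (q : ℂ) ^ (2 * k + 1) * z) * (1 + (q : ℂ) ^ (2 * k + 1) * z⁻¹))) atTop
      (𝓝 (L * ∑' j : ℤ, ((q ^ (j ^ 2) : ℝ) : ℂ) * z ^ j)) := by
  have hQ0 : 0 < q ^ 2 := by positivity
  have hQ1 : q ^ 2 < 1 := pow_lt_one₀ h0.le h1 two_ne_zero
  obtain ⟨L, hL, hlim, hle⟩ := Qp_lim hQ0 hQ1
  refine ⟨L⁻¹, inv_pos.2 hL, fun z hz => ?_⟩
  have hz0 : z ≠ 0 := by rintro rfl; simp at hz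
  have hr : Tendsto (rr (q ^ 2)) atTop (𝓝 L⁻¹) := by
    have : Tendsto (fun k : ℤ => (Qp (q ^ 2) k.toNat)⁻¹) atTop (𝓝 L⁻¹) :=
      (hlim.comp (tendsto_atTop.2 fun b => by
        filter_upwards [eventually_ge_atTop (b : ℤ)] with k hk; omega)).inv₀ hL.ne'
    refine this.congr' ?_
    filter_upwards [eventually_ge_atTop (0 : ℤ)] with k hk
    simp [rr, hk]
  have hcc : ∀ j : ℤ, Tendsto (fun m => cc q m j) atTop (𝓝 (L⁻¹ * q ^ (j ^ 2))) := by
    intro j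
    have t1 : Tendsto (fun m : ℕ => Qp (q ^ 2) (2 * m)) atTop (𝓝 L) :=
      hlim.comp (tendsto_atTop.2 fun b => by
        filter_upwards [eventually_ge_atTop b] with k hk; omega)
    have t2 : Tendsto (fun m : ℕ => rr (q ^ 2) ((m : ℤ) + j)) atTop (𝓝 L⁻¹) :=
      hr.comp (tendsto_atTop.2 fun b => by
        filter_upwards [eventually_ge_atTop (b - j).toNat] with k hk; omega)
    have t3 : Tendsto (fun m : ℕ => rr (q ^ 2) ((m : ℤ) - j)) atTop (𝓝 L⁻¹) :=
      hr.comp (tendsto_atTop.2 fun b => by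
        filter_upwards [eventually_ge_atTop (b + j).toNat] with k hk; omega)
    have := ((t1.const_mul (q ^ (j ^ 2))).mul t2).mul t3
    convert! this using 2
    field_simp
  rw [← tsum_mul_left]
  have := tendsto_tsum_of_dominated_convergence (𝓕 := atTop)
    (f := fun (m : ℕ) (j : ℤ) => (cc q m j : ℂ) * z ^ j)
    (g := fun j : ℤ => ((L⁻¹ : ℝ) : ℂ) * (((q ^ (j ^ 2) : ℝ) : ℂ) * z ^ j))
    (bound := fun j : ℤ => q ^ (j ^ 2) * (L⁻¹ * L⁻¹)) ((summable_gauss h0 h1).mul_right _) ?_ ?_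
  · refine this.congr fun m => (finite_jtp h0 h1 z hz0 m).tsum_eq
  · intro j
    have := ((Complex.continuous_ofReal.tendsto _).comp (hcc j)).mul_const (z ^ j)
    simpa [Function.comp_def, mul_assoc] using this
  · refine Eventually.of_forall fun m j => ?_
    rw [norm_mul, norm_zpow, hz, one_zpow, mul_one, Complex.norm_real, Real.norm_eq_abs]
    have n1 := rr_nonneg hQ0 hQ1 (m + j)
    have n2 := rr_nonneg hQ0 hQ1 (m - j)
    have n3 := (Qp_pos hQ0 hQ1 (2 * m)).le
    have n4 := Qp_le_one hQ0 hQ1 (2 * m)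
    have n5 := rr_le hL hle (m + j)
    have n6 := rr_le hL hle (m - j)
    unfold cc
    rw [abs_of_nonneg (by positivity)]
    calc q ^ (j ^ 2) * Qp (q ^ 2) (2 * m) * rr (q ^ 2) (m + j) * rr (q ^ 2) (m - j)
        ≤ q ^ (j ^ 2) * 1 * L⁻¹ * L⁻¹ := by gcongr
      _ = _ := by ring

section RR
variable {R : ℕ → ℕ → ℝ} {x : ℕ → ℝ}

lemma bern {s x : ℝ} (hs : 0 ≤ s) (hx : 0 ≤ x) (N : ℕ) :
    s ^ (N + 1) + (N + 1) * x * s ^ N ≤ (s + x) ^ (N + 1) := by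
  induction N with
  | zero => simp
  | succ N ih =>
    rw [pow_succ (s + x)]
    have h1 := mul_le_mul_of_nonneg_right ih (add_nonneg hs hx)
    refine le_trans ?_ h1
    have : 0 ≤ (N + 1) * x * x * s ^ N := by positivity
    push_cast
    ring_nf
    ring_nf at this
    linarith

lemma RR_nonneg (h0 : ∀ m, R 0 m = 1) (h1 : ∀ N, R (N + 1) 0 = 0)
    (h2 : ∀ N m, R (N + 1) (m + 1) = R (N + 1) m + (N + 1) * x m * R N m) (hx : ∀ k, 0 ≤ x k)
    (N m : ℕ) : 0 ≤ R N m := by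
  induction m generalizing N with
  | zero => cases N <;> simp [h0, h1]
  | succ m ih =>
    cases N with
    | zero => simp [h0]
    | succ N => rw [h2]; have := ih N; have := ih (N + 1); have := hx m; positivity

lemma RR_upper (h0 : ∀ m, R 0 m = 1) (h1 : ∀ N, R (N + 1) 0 = 0)
    (h2 : ∀ N m, R (N + 1) (m + 1) = R (N + 1) m + (N + 1) * x m * R N m) (hx : ∀ k, 0 ≤ x k)
    (N m : ℕ) : R N m ≤ (∑ k ∈ Finset.range m, x k) ^ N := by
  induction m generalizing N with
  | zero => cases N <;> simp [h0, h1]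
  | succ m ih =>
    cases N with
    | zero => simp [h0]
    | succ N =>
      rw [h2, Finset.sum_range_succ]
      refine le_trans ?_ (bern (Finset.sum_nonneg fun k _ => hx k) (hx m) N)
      have := hx m
      gcongr
      · exact ih _
      · exact ih _

lemma RR_mono (h0 : ∀ m, R 0 m = 1) (h1 : ∀ N, R (N + 1) 0 = 0)
    (h2 : ∀ N m, R (N + 1) (m + 1) = R (N + 1) m + (N + 1) * x m * R N m) (hx : ∀ k, 0 ≤ x k)
    (N : ℕ) : Monotone (R N) := by
  refine monotone_nat_of_le_succ fun m => ?_
  cases N with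
  | zero => simp [h0]
  | succ N =>
    rw [h2]
    have := hx m
    have := RR_nonneg h0 h1 h2 hx N m
    have : 0 ≤ (N + 1) * x m * R N m := by positivity
    linarith

lemma RR_lower (h0 : ∀ m, R 0 m = 1) (h1 : ∀ N, R (N + 1) 0 = 0)
    (h2 : ∀ N m, R (N + 1) (m + 1) = R (N + 1) m + (N + 1) * x m * R N m)
    {y : ℝ} (hy : 0 ≤ y) (N m : ℕ) (hxy : ∀ k < m, y ≤ x k) :
    (m.descFactorial N : ℝ) * y ^ N ≤ R N m := by
  induction m generalizing N with
  | zero => cases N <;> simp [h0, h1]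
  | succ m ih =>
    cases N with
    | zero => simp [h0]
    | succ N =>
      have i1 := ih (N + 1) (fun k hk => hxy k (by omega))
      have i2 := ih N (fun k hk => hxy k (by omega))
      have hm := hxy m (by omega)
      have e : ((m + 1).descFactorial (N + 1) : ℝ) =
          m.descFactorial (N + 1) + (N + 1) * m.descFactorial N := by
        rw [Nat.succ_descFactorial_succ, Nat.descFactorial_succ]
        rcases le_or_gt N m with h | h
        · push_cast [h]; ring
        · simp [Nat.descFactorial_of_lt h]
      rw [h2, e]
      calc (m.descFactorial (N + 1) + (N + 1) * m.descFactorial N) * y ^ (N + 1)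
          = m.descFactorial (N + 1) * y ^ (N + 1) +
            (N + 1) * y * (m.descFactorial N * y ^ N) := by ring
        _ ≤ R (N + 1) m + (N + 1) * x m * R N m := by
          have : 0 ≤ x m := hy.trans hm
          gcongr
end RR

open Polynomial in
noncomputable def pp (q : ℝ) (m : ℕ) : Polynomial ℝ :=
  ∏ k ∈ Finset.range m, (C (2 * q ^ (2 * k + 1)) * X + C (1 + q ^ (4 * k + 2)))

open Polynomial in
lemma iter_deriv_lin (p : ℝ[X]) (b d : ℝ) (N : ℕ) :
    derivative^[N + 1] (p * (C b * X + C d)) =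
      derivative^[N + 1] p * (C b * X + C d) + C ((N + 1) * b) * derivative^[N] p := by
  induction N with
  | zero => simp; ring
  | succ N ih =>
    rw [Function.iterate_succ_apply', ih, Function.iterate_succ_apply' _ (N + 1),
      Function.iterate_succ_apply' _ N]
    simp
    ring

lemma cosh_lower (s : ℝ) : 1 + s ^ 2 / 2 ≤ Real.cosh s := by
  have h := Real.cosh_two_mul (s / 2)
  have h2 := Real.cosh_sq (s / 2)
  rw [show 2 * (s / 2) = s by ring] at h
  have h3 : (s / 2) ^ 2 ≤ Real.sinh (s / 2) ^ 2 := by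
    rw [sq_le_sq, Real.abs_sinh]
    exact Real.self_le_sinh_iff.2 (abs_nonneg _)
  rw [h, h2]; nlinarith

lemma cosh_upper (s : ℝ) : Real.cosh s ≤ 1 + s ^ 2 / 2 * Real.exp (s ^ 2 / 2) := by
  refine (Real.cosh_le_exp_half_sq s).trans ?_
  have h := Real.add_one_le_exp (-(s ^ 2 / 2))
  have h2 := Real.exp_pos (s ^ 2 / 2)
  have h3 : Real.exp (-(s ^ 2 / 2)) * Real.exp (s ^ 2 / 2) = 1 := by rw [← Real.exp_add]; simp
  nlinarith

/-- reciprocal roots -/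
noncomputable def xx (t u : ℝ) (k : ℕ) : ℝ := (u + Real.cosh ((2 * k + 1) * t))⁻¹

lemma den_pos {t φ : ℝ} (ht : 0 < t) (k : ℕ) : 0 < Real.cos φ + Real.cosh ((2 * k + 1) * t) := by
  have h1 := Real.neg_one_le_cos φ
  have h2 := cosh_lower ((2 * k + 1) * t)
  have : 0 < ((2 * k + 1) * t) ^ 2 := by positivity
  linarith

lemma factor_eq {t u : ℝ} (k : ℕ) :
    2 * Real.exp (-t) ^ (2 * k + 1) * u + (1 + Real.exp (-t) ^ (4 * k + 2)) =
      2 * Real.exp (-t) ^ (2 * k + 1) * (u + Real.cosh ((2 * k + 1) * t)) := by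
  have e1 : Real.exp (-t) ^ (2 * k + 1) = Real.exp (-((2 * k + 1) * t)) := by
    rw [← Real.exp_nat_mul]; congr 1; push_cast; ring
  have e2 : Real.exp (-t) ^ (4 * k + 2) =
      Real.exp (-((2 * k + 1) * t)) * Real.exp (-((2 * k + 1) * t)) := by
    rw [← Real.exp_nat_mul, ← Real.exp_add]; congr 1; push_cast; ring
  have e3 : Real.exp (-((2 * k + 1) * t)) * Real.exp ((2 * k + 1) * t) = 1 := by
    rw [← Real.exp_add]; simp
  rw [e1, e2, Real.cosh_eq]
  linear_combination -e3

lemma pp_succ_eval (q u : ℝ) (m : ℕ) : (pp q (m + 1)).eval u =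
    (pp q m).eval u * (2 * q ^ (2 * m + 1) * u + (1 + q ^ (4 * m + 2))) := by
  simp [pp, Finset.prod_range_succ]

lemma pp_pos {t φ : ℝ} (ht : 0 < t) (m : ℕ) : 0 < (pp (Real.exp (-t)) m).eval (Real.cos φ) := by
  induction m with
  | zero => simp [pp]
  | succ m ih =>
    rw [pp_succ_eval, factor_eq]
    have := den_pos (φ := φ) ht m
    positivity

open Polynomial in
noncomputable def Rr (t φ : ℝ) (N m : ℕ) : ℝ :=
  (derivative^[N] (pp (Real.exp (-t)) m)).eval (Real.cos φ) / (pp (Real.exp (-t)) m).eval (Real.cos φ)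

lemma Rr_zero {t φ : ℝ} (ht : 0 < t) (m : ℕ) : Rr t φ 0 m = 1 := by
  simp [Rr, (pp_pos (φ := φ) ht m).ne']

lemma Rr_succ_zero {t φ : ℝ} (N : ℕ) : Rr t φ (N + 1) 0 = 0 := by
  simp [Rr, pp]

lemma Rr_rec {t φ : ℝ} (ht : 0 < t) (N m : ℕ) : Rr t φ (N + 1) (m + 1) =
    Rr t φ (N + 1) m + (N + 1) * xx t (Real.cos φ) m * Rr t φ N m := by
  have h1 := (pp_pos (φ := φ) ht m).ne'
  have h2 := (den_pos (φ := φ) ht m).ne'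
  have h3 := (Real.exp_pos (-t)).ne'
  have e : pp (Real.exp (-t)) (m + 1) = pp (Real.exp (-t)) m * (Polynomial.C (2 * (Real.exp (-t)) ^ (2 * m + 1)) * Polynomial.X + Polynomial.C (1 + (Real.exp (-t)) ^ (4 * m + 2))) := by
    simp [pp, Finset.prod_range_succ]
  unfold Rr
  rw [pp_succ_eval, e, iter_deriv_lin]
  simp only [Polynomial.eval_add, Polynomial.eval_mul, Polynomial.eval_C, Polynomial.eval_X]
  rw [factor_eq, xx]
  generalize Real.cos φ + Real.cosh ((2 * m + 1) * t) = D at *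
  field_simp

lemma sum_xx_le {t φ : ℝ} (ht : 0 < t) (hφ : φ ∈ Set.Ioo 0 Real.pi) (m : ℕ) :
    ∑ k ∈ Finset.range m, xx t (Real.cos φ) k ≤ 20 * (t * (t + Real.pi - φ))⁻¹ := by
  set ψ := Real.pi - φ with hψ
  have hψ0 : 0 < ψ := sub_pos.2 hφ.2
  have hcos : Real.cos φ = - Real.cos ψ := by rw [hψ, Real.cos_pi_sub]; ring
  have hc := Real.cos_le_one_sub_mul_cos_sq (x := ψ) (by rw [abs_of_pos hψ0]; linarith [hφ.1])
  have hpi : 1 / 5 ≤ 2 / Real.pi ^ 2 := by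
    rw [div_le_div_iff₀ (by norm_num) (by positivity)]
    nlinarith [Real.pi_lt_d2, Real.pi_pos]
  have hk : ∀ k : ℕ, xx t (Real.cos φ) k ≤
      10 / t * (((k + 1 / 2) * t + ψ)⁻¹ - (((k + 1 : ℕ) + 1 / 2) * t + ψ)⁻¹) := by
    intro k
    have h1 := cosh_lower ((2 * k + 1) * t)
    have h2 : ((k + 1) * t + ψ) ^ 2 / 10 ≤ Real.cos φ + Real.cosh ((2 * k + 1) * t) := by
      rw [hcos]
      have h3 : 1 / 5 * ψ ^ 2 ≤ 2 / Real.pi ^ 2 * ψ ^ 2 := by gcongr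
      have h4 : ((k + 1) * t) ^ 2 ≤ ((2 * k + 1) * t) ^ 2 := by
        gcongr
        have : (0 : ℝ) ≤ k := by positivity
        linarith
      nlinarith [sq_nonneg ((k + 1) * t - ψ), sq_nonneg ((k + 1) * t)]
    have e : 10 / t * (((k + 1 / 2) * t + ψ)⁻¹ - (((k + 1 : ℕ) + 1 / 2) * t + ψ)⁻¹) =
        ((((k + 1) * t + ψ) ^ 2 - t ^ 2 / 4) / 10)⁻¹ := by
      have n1 : (k + 1 / 2) * t + ψ ≠ 0 := by positivity
      have n2 : ((k + 1 : ℕ) + 1 / 2) * t + ψ ≠ 0 := by positivity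
      have : ((k + 1) * t + ψ) ^ 2 - t ^ 2 / 4 = ((k + 1 / 2) * t + ψ) * (((k + 1 : ℕ) + 1 / 2) * t + ψ) := by
        push_cast; ring
      rw [this, inv_sub_inv n1 n2, show ((k + 1 : ℕ) + 1 / 2) * t + ψ - ((k + 1 / 2) * t + ψ) = t by
        push_cast; ring]
      field_simp
    rw [e, xx]
    apply inv_anti₀
    · have : 0 < t * (k + 1 / 2) := by positivity
      have : (t / 2) ^ 2 < ((k + 1) * t + ψ) ^ 2 := by
        apply pow_lt_pow_left₀ _ (by positivity) two_ne_zero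
        nlinarith
      linarith
    · have : 0 < t ^ 2 := by positivity
      linarith
  calc ∑ k ∈ Finset.range m, xx t (Real.cos φ) k
      ≤ ∑ k ∈ Finset.range m, 10 / t * (((k + 1 / 2) * t + ψ)⁻¹ - (((k + 1 : ℕ) + 1 / 2) * t + ψ)⁻¹) :=
        Finset.sum_le_sum fun k _ => hk k
    _ = 10 / t * ((((0 : ℕ) + 1 / 2) * t + ψ)⁻¹ - ((m + 1 / 2) * t + ψ)⁻¹) := by
        rw [← Finset.mul_sum, Finset.sum_range_sub' (fun k : ℕ => (((k : ℝ) + 1 / 2) * t + ψ)⁻¹)]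
    _ ≤ 10 / t * (((0 : ℕ) + 1 / 2) * t + ψ)⁻¹ := by
        gcongr
        have : 0 ≤ ((m + 1 / 2) * t + ψ)⁻¹ := by positivity
        linarith
    _ ≤ 10 / t * ((t + ψ) / 2)⁻¹ := by
        gcongr
        push_cast
        linarith
    _ = 20 * (t * (t + Real.pi - φ))⁻¹ := by
        rw [show t + Real.pi - φ = t + ψ by rw [hψ]; ring]
        field_simp
        norm_num

lemma xx_lower {t φ : ℝ} (ht : 0 < t) (ht1 : t ≤ 1) (hφ : φ ∈ Set.Ioo 0 Real.pi) (N k : ℕ)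
    (hk : k < N + ⌊(Real.pi - φ) / t⌋₊) :
    (3 * (N + 1) ^ 2 * Real.exp (50 * (N + 1) ^ 2) * (t + Real.pi - φ) ^ 2)⁻¹ ≤
      xx t (Real.cos φ) k := by
  rw [show t + Real.pi - φ = t + (Real.pi - φ) by ring]
  set ψ := Real.pi - φ with hψ
  have hψ0 : 0 < ψ := sub_pos.2 hφ.2
  have hcos : Real.cos φ = - Real.cos ψ := by rw [hψ, Real.cos_pi_sub]; ring
  have hc := Real.one_sub_sq_div_two_le_cos (x := ψ)
  refine inv_anti₀ (den_pos ht k) ?_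
  set s := (2 * k + 1) * t with hs
  have hs0 : 0 ≤ s := by positivity
  have hfl : (⌊ψ / t⌋₊ : ℝ) * t ≤ ψ := by
    have := Nat.floor_le (show 0 ≤ ψ / t by positivity)
    rwa [le_div_iff₀ ht] at this
  have hs1 : s ≤ 2 * (N + 1) * (t + ψ) := by
    have : (k : ℝ) + 1 ≤ N + ⌊ψ / t⌋₊ := by exact_mod_cast hk
    have h2 : ((k : ℝ) + 1) * t ≤ (N + ⌊ψ / t⌋₊) * t := by gcongr
    have h3 : 0 ≤ N * ψ := by positivity
    rw [hs]
    nlinarith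
  have hs2 : s ≤ 10 * (N + 1) := by
    have : t + ψ ≤ 5 := by have := Real.pi_lt_d2; have := hφ.1; linarith
    have : (N + 1) * (t + ψ) ≤ (N + 1) * 5 := by gcongr
    linarith
  have hE : Real.exp (s ^ 2 / 2) ≤ Real.exp (50 * (N + 1) ^ 2) := by
    apply Real.exp_le_exp.2
    have : s ^ 2 ≤ (10 * (N + 1)) ^ 2 := by gcongr
    linarith
  have hE1 : 1 ≤ Real.exp (50 * (N + 1) ^ 2) := Real.one_le_exp (by positivity)
  set E := Real.exp (50 * (N + 1) ^ 2)
  have h1 := cosh_upper s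
  have h2 : s ^ 2 / 2 * Real.exp (s ^ 2 / 2) ≤ (2 * (N + 1) * (t + ψ)) ^ 2 / 2 * E := by gcongr
  have h3 : ψ ^ 2 ≤ (t + ψ) ^ 2 := by gcongr; linarith
  have h4 : 1 * 1 * (t + ψ) ^ 2 ≤ (N + 1) ^ 2 * E * (t + ψ) ^ 2 := by
    gcongr
    have : (0 : ℝ) ≤ N := by positivity
    nlinarith
  rw [hcos]
  nlinarith

lemma core {t φ : ℝ} (ht : 0 < t) (ht1 : t ≤ 1) (hφ : φ ∈ Set.Ioo 0 Real.pi) (N m : ℕ)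
    (hm : N + ⌊(Real.pi - φ) / t⌋₊ ≤ m) :
    ((6 * (N + 1) ^ 2 * Real.exp (50 * (N + 1) ^ 2))⁻¹ * (t * (t + Real.pi - φ))⁻¹) ^ N ≤ Rr t φ N m ∧
    Rr t φ N m ≤ (20 * (t * (t + Real.pi - φ))⁻¹) ^ N := by
  have hx : ∀ k, 0 ≤ xx t (Real.cos φ) k := fun k => (inv_pos.2 (den_pos ht k)).le
  have hψ0 : 0 < Real.pi - φ := sub_pos.2 hφ.2
  have hψ1 : 0 < t + Real.pi - φ := by linarith
  constructor
  · refine le_trans ?_ (RR_mono (Rr_zero ht) Rr_succ_zero (Rr_rec ht) hx N hm)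
    refine le_trans ?_ (RR_lower (x := xx t (Real.cos φ)) (Rr_zero ht) Rr_succ_zero (Rr_rec ht)
      (y := (3 * (N + 1) ^ 2 * Real.exp (50 * (N + 1) ^ 2) * (t + Real.pi - φ) ^ 2)⁻¹) (by positivity) N
      (N + ⌊(Real.pi - φ) / t⌋₊) (fun k hk => xx_lower ht ht1 hφ N k hk))
    have h1 := Nat.pow_sub_le_descFactorial (N + ⌊(Real.pi - φ) / t⌋₊) N
    rw [show N + ⌊(Real.pi - φ) / t⌋₊ + 1 - N = ⌊(Real.pi - φ) / t⌋₊ + 1 by omega] at h1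
    have h2 : ((⌊(Real.pi - φ) / t⌋₊ : ℝ) + 1) ^ N ≤ ((N + ⌊(Real.pi - φ) / t⌋₊).descFactorial N : ℝ) := by
      exact_mod_cast h1
    have h3 : (t + Real.pi - φ) / (2 * t) ≤ (⌊(Real.pi - φ) / t⌋₊ : ℝ) + 1 := by
      have a := Nat.lt_floor_add_one ((Real.pi - φ) / t)
      rw [div_lt_iff₀ ht] at a
      rw [div_le_iff₀ (by positivity)]
      have : (0 : ℝ) ≤ ⌊(Real.pi - φ) / t⌋₊ := by positivity
      nlinarith
    calc _ = ((t + Real.pi - φ) / (2 * t)) ^ N * ((3 * (N + 1) ^ 2 * Real.exp (50 * (N + 1) ^ 2) * (t + Real.pi - φ) ^ 2)⁻¹) ^ N := by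
          rw [← mul_pow]; congr 1; field_simp; norm_num
      _ ≤ ((⌊(Real.pi - φ) / t⌋₊ : ℝ) + 1) ^ N * ((3 * (N + 1) ^ 2 * Real.exp (50 * (N + 1) ^ 2) * (t + Real.pi - φ) ^ 2)⁻¹) ^ N := by
          gcongr
      _ ≤ _ := by gcongr
  · refine (RR_upper (Rr_zero ht) Rr_succ_zero (Rr_rec ht) hx N m).trans ?_
    exact pow_le_pow_left₀ (Finset.sum_nonneg fun k _ => hx k) (sum_xx_le ht hφ m) N

open Polynomial in
lemma lim_g {q : ℝ} (h0 : 0 < q) (h1 : q < 1) : ∃ g : ℕ → ℝ → ℝ, ∀ (N : ℕ) (u : ℝ), |u| < 2 →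
    Tendsto (fun m => (derivative^[N] (pp q m)).eval u) atTop (𝓝 (g N u)) ∧
    HasDerivAt (g N) (g (N + 1) u) u := by
  have hU : IsOpen (Metric.ball (0 : ℂ) 2) := Metric.isOpen_ball
  have hsum : Summable (fun k : ℕ => 5 * q ^ k) := (summable_geometric_of_lt_one h0.le h1).mul_left 5
  have hprod := Summable.hasProdLocallyUniformlyOn_nat_one_add
    (f := fun (k : ℕ) (w : ℂ) => 2 * (q : ℂ) ^ (2 * k + 1) * w + (q : ℂ) ^ (4 * k + 2)) hU hsum
    (Eventually.of_forall fun k w hw => by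
      have hw' : ‖w‖ ≤ 2 := by simpa using (mem_ball_zero_iff.1 hw).le
      have a1 : q ^ (2 * k + 1) ≤ q ^ k := pow_le_pow_of_le_one h0.le h1.le (by omega)
      have a2 : q ^ (4 * k + 2) ≤ q ^ k := pow_le_pow_of_le_one h0.le h1.le (by omega)
      refine (norm_add_le _ _).trans ?_
      simp only [norm_mul, norm_pow, Complex.norm_real, Real.norm_eq_abs, abs_of_pos h0,
        Complex.norm_ofNat]
      have : 2 * q ^ (2 * k + 1) * ‖w‖ ≤ 2 * q ^ k * 2 := by gcongr
      linarith)
    (fun k => by fun_prop)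
  have ht := hprod.tendstoLocallyUniformlyOn_finsetRange
  set f : ℂ → ℂ := fun w => ∏' k : ℕ, (1 + (2 * (q : ℂ) ^ (2 * k + 1) * w + (q : ℂ) ^ (4 * k + 2)))
  have key : ∀ N : ℕ, TendstoLocallyUniformlyOn
      (fun m w => (derivative^[N] ((pp q m).map Complex.ofRealHom)).eval w) (deriv^[N] f) atTop
      (Metric.ball (0 : ℂ) 2) := by
    intro N
    induction N with
    | zero =>
      convert! ht using 3 with m w
      simp only [Function.iterate_zero, id, pp, Polynomial.map_prod, Polynomial.eval_prod]
      refine Finset.prod_congr rfl fun k _ => ?_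
      simp
      ring
    | succ N ih =>
      have := ih.deriv (Eventually.of_forall fun m =>
        (Polynomial.differentiable _).differentiableOn) hU
      rw [← Function.iterate_succ_apply' deriv] at this
      convert! this using 3 with m w
      simp [Function.iterate_succ_apply']
  refine ⟨fun N u => (deriv^[N] f (u : ℂ)).re, fun N u hu => ?_⟩
  have hmem : (u : ℂ) ∈ Metric.ball (0 : ℂ) 2 := by simpa using hu
  constructor
  · have h := (Complex.continuous_re.tendsto _).comp ((key N).tendsto_at hmem)
    refine h.congr fun m => ?_
    simp only [Function.comp]
    rw [Polynomial.iterate_derivative_map, Polynomial.eval_map, ← Complex.ofRealHom_eq_coe,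
      Polynomial.eval₂_at_apply]
    simp
  · have hd := (key N).differentiableOn (Eventually.of_forall fun m =>
        (Polynomial.differentiable _).differentiableOn) hU
    have hd2 := (hd.differentiableAt (hU.mem_nhds hmem)).hasDerivAt
    have := hd2.real_of_complex
    rw [← Function.iterate_succ_apply' deriv] at this
    exact this

lemma W_bound {t φ : ℝ} (ht : 0 < t) (ht1 : t ≤ 1) (hφ : φ ∈ Set.Ioo 0 Real.pi) (n : ℤ) :
    W t (φ + 2 * Real.pi * n) ≤ W t φ * Real.exp (1 - |(n : ℝ)|) := by
  unfold W
  rw [mul_assoc (1 / Real.sqrt (4 * Real.pi * t)), ← Real.exp_add]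
  gcongr
  have hpi := Real.pi_gt_three
  have key : 4 * (|(n : ℝ)| - 1) ≤ (φ + 2 * Real.pi * n) ^ 2 - φ ^ 2 := by
    have e : (φ + 2 * Real.pi * n) ^ 2 - φ ^ 2 = 4 * Real.pi * (n * φ + Real.pi * n ^ 2) := by ring
    have hN : |(n : ℝ)| = 0 ∨ 1 ≤ |(n : ℝ)| := by
      rcases eq_or_ne n 0 with h | h
      · left; simp [h]
      · right; exact_mod_cast Int.one_le_abs h
    have hge : -(|(n : ℝ)| * Real.pi) ≤ n * φ := by
      have h1 := neg_abs_le ((n : ℝ) * φ)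
      rw [abs_mul, abs_of_pos hφ.1] at h1
      have : |(n : ℝ)| * φ ≤ |(n : ℝ)| * Real.pi := by gcongr; exact hφ.2.le
      linarith
    rw [e, ← sq_abs (n : ℝ)]
    set a := |(n : ℝ)|
    rcases hN with h | h
    · rw [h] at hge ⊢; nlinarith
    · have h5 : a - 1 ≤ a * (a - 1) := by nlinarith
      have h6 : 0 ≤ a - 1 := by linarith
      have h7 : Real.pi * (a * (a - 1)) ≤ n * φ + Real.pi * a ^ 2 := by nlinarith
      have h8 : a - 1 ≤ Real.pi * (a * (a - 1)) := by nlinarith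
      nlinarith
  rcases le_or_gt 1 |(n : ℝ)| with h | h
  · have h2 : (|(n : ℝ)| - 1) * (4 * t) ≤ 4 * (|(n : ℝ)| - 1) := by nlinarith
    have : |(n : ℝ)| - 1 ≤ ((φ + 2 * Real.pi * n) ^ 2 - φ ^ 2) / (4 * t) := by
      rw [le_div_iff₀ (by positivity)]; linarith
    have e : ((φ + 2 * Real.pi * n) ^ 2 - φ ^ 2) / (4 * t) =
      -φ ^ 2 / (4 * t) - (-(φ + 2 * Real.pi * n) ^ 2 / (4 * t)) := by ring
    linarith
  · have : n = 0 := by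
      have : |n| < 1 := by exact_mod_cast h
      exact Int.abs_lt_one_iff.1 this
    subst this
    simp

lemma summable_expabs : Summable (fun n : ℤ => Real.exp (1 - |(n : ℝ)|)) := by
  have key : Summable (fun n : ℕ => Real.exp (1 - (n : ℝ))) := by
    have := (summable_geometric_of_lt_one (Real.exp_pos (-1)).le (Real.exp_lt_one_iff.2 (by norm_num))).mul_left (Real.exp 1)
    refine this.congr fun n => ?_
    rw [← Real.exp_nat_mul, ← Real.exp_add]; congr 1; ring
  refine Summable.of_nat_of_neg ?_ ?_ <;> simpa using key

lemma W_pos {t : ℝ} (ht : 0 < t) (x : ℝ) : 0 < W t x := by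
  have := Real.pi_pos
  unfold W; positivity

lemma theta_bounds_s4 {t φ : ℝ} (ht : 0 < t) (ht1 : t ≤ 1) (hφ : φ ∈ Set.Ioo 0 Real.pi) :
    W t φ ≤ theta t φ ∧ theta t φ ≤ W t φ * ∑' n : ℤ, Real.exp (1 - |(n : ℝ)|) := by
  have hs2 := summable_expabs.mul_left (W t φ)
  have hs : Summable (fun n : ℤ => W t (φ + 2 * Real.pi * n)) :=
    Summable.of_nonneg_of_le (fun n => (W_pos ht _).le) (fun n => W_bound ht ht1 hφ n) hs2
  constructor
  · have := hs.le_tsum 0 (fun j _ => (W_pos ht _).le)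
    simpa [theta] using this
  · rw [← tsum_mul_left]
    exact hs.tsum_le_tsum (fun n => W_bound ht ht1 hφ n) hs2

lemma poisson {t : ℝ} (ht : 0 < t) : ∃ K : ℝ, 0 < K ∧ ∀ φ : ℝ,
    ∑' j : ℤ, ((Real.exp (-t) ^ (j ^ 2) : ℝ) : ℂ) * (Complex.exp (-(φ * Complex.I))) ^ j =
      ((K * theta t φ : ℝ) : ℂ) := by
  have hpi := Real.pi_pos
  refine ⟨1 / (t / Real.pi) ^ (1 / 2 : ℝ) * Real.sqrt (4 * Real.pi * t), by positivity, fun φ => ?_⟩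
  have h := Complex.tsum_exp_neg_quadratic (a := ((t / Real.pi : ℝ) : ℂ))
    (by rw [Complex.ofReal_re]; positivity) (-(φ * Complex.I) / (2 * Real.pi))
  have hpc : (Real.pi : ℂ) ≠ 0 := by exact_mod_cast hpi.ne'
  have htc : (t : ℂ) ≠ 0 := by exact_mod_cast ht.ne'
  convert! h using 1
  · congr 1
    ext j
    rw [Complex.ofReal_zpow, Complex.ofReal_exp, ← Complex.exp_int_mul, ← Complex.exp_int_mul, ← Complex.exp_add]
    congr 1
    push_cast
    field_simp
    try ring
  · rw [mul_assoc, Complex.ofReal_mul, theta, ← tsum_mul_left, Complex.ofReal_tsum]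
    congr 1
    · rw [Complex.ofReal_div, Complex.ofReal_cpow (by positivity)]; simp
    · congr 1
      ext j
      have hsq : Real.sqrt (4 * Real.pi * t) ≠ 0 := by positivity
      rw [W, ← mul_assoc, mul_one_div_cancel hsq, one_mul, Complex.ofReal_exp]
      congr 1
      have hI := Complex.I_sq
      have : Complex.I * (-(φ * Complex.I) / (2 * Real.pi)) = φ / (2 * Real.pi) := by
        linear_combination (-(φ : ℂ) / (2 * Real.pi)) * hI
      rw [this]
      push_cast
      field_simp
      try ring

lemma g_zero {t : ℝ} (ht : 0 < t) {g : ℝ → ℝ}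
    (hg : ∀ u, |u| < 2 → Tendsto (fun m => (pp (Real.exp (-t)) m).eval u) atTop (𝓝 (g u))) :
    ∃ A : ℝ, 0 < A ∧ ∀ φ : ℝ, g (Real.cos φ) = A * theta t φ := by
  obtain ⟨L, hL, hlim⟩ := jtp (Real.exp_pos (-t)) (Real.exp_lt_one_iff.2 (by linarith))
  obtain ⟨K, hK, hp⟩ := poisson ht
  refine ⟨L * K, by positivity, fun φ => ?_⟩
  have h1 := hg (Real.cos φ) (by have := Real.abs_cos_le_one φ; linarith)
  have h2 := hlim (Complex.exp (-(φ * Complex.I))) (by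
    rw [← neg_mul, ← Complex.ofReal_neg, Complex.norm_exp_ofReal_mul_I])
  rw [hp φ] at h2
  have h3 := (Complex.continuous_ofReal.tendsto _).comp h1
  have h4 : (g (Real.cos φ) : ℂ) = L * ((K * theta t φ : ℝ) : ℂ) := by
    refine tendsto_nhds_unique h3 (h2.congr fun m => ?_)
    simp only [Function.comp, pp, Polynomial.eval_prod, Complex.ofReal_prod]
    refine Finset.prod_congr rfl fun k _ => ?_
    have hc := Complex.two_cos (φ : ℂ)
    have e : Complex.exp (-(φ * Complex.I)) * Complex.exp (φ * Complex.I) = 1 := by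
      rw [← Complex.exp_add]; simp
    rw [← Complex.exp_neg, neg_neg]
    rw [neg_mul] at hc
    simp only [Polynomial.eval_add, Polynomial.eval_mul, Polynomial.eval_C, Polynomial.eval_X]
    push_cast
    have e2 : Complex.exp (-(t : ℂ)) ^ (4 * k + 2) =
      Complex.exp (-(t : ℂ)) ^ (2 * k + 1) * Complex.exp (-(t : ℂ)) ^ (2 * k + 1) := by ring
    rw [e2]
    linear_combination Complex.exp (-(t : ℂ)) ^ (2 * k + 1) * Complex.exp (-(t : ℂ)) ^ (2 * k + 1) * e
      - Complex.exp (-(t : ℂ)) ^ (2 * k + 1) * hc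
  have h5 : g (Real.cos φ) = L * (K * theta t φ) := by exact_mod_cast h4
  rw [h5]; ring

lemma negD_iter_s4 {t A : ℝ} (hA : 0 < A) {g : ℕ → ℝ → ℝ}
    (hg : ∀ (N : ℕ) (u : ℝ), |u| < 2 → HasDerivAt (g N) (g (N + 1) u) u)
    (h0 : ∀ φ : ℝ, g 0 (Real.cos φ) = A * theta t φ) (N : ℕ) :
    ∀ φ ∈ Set.Ioo 0 Real.pi, (negD^[N] (theta t)) φ = A⁻¹ * g N (Real.cos φ) := by
  induction N with
  | zero => intro φ _; simp only [Function.iterate_zero, id]; rw [h0]; field_simp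
  | succ N ih =>
    intro φ hφ
    rw [Function.iterate_succ_apply', negD]
    have hev : negD^[N] (theta t) =ᶠ[𝓝 φ] fun φ => A⁻¹ * g N (Real.cos φ) :=
      Filter.eventually_of_mem (isOpen_Ioo.mem_nhds hφ) ih
    have hd : HasDerivAt (fun φ => A⁻¹ * g N (Real.cos φ)) (A⁻¹ * (g (N + 1) (Real.cos φ) * -Real.sin φ)) φ :=
      ((hg N (Real.cos φ) (by have := Real.abs_cos_le_one φ; linarith)).comp φ
        (Real.hasDerivAt_cos φ)).const_mul _
    rw [hev.deriv_eq, hd.deriv]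
    have := (Real.sin_pos_of_pos_of_lt_pi hφ.1 hφ.2).ne'
    field_simp

/-- Sharp estimate for `((-D)^N θ_t)(φ)` for small times (Theorem 4.1 of the paper). -/
theorem negD_iter_theta_sharp_estimate (N : ℕ) :
    ∃ t₀ : ℝ, 0 < t₀ ∧ ∃ c C : ℝ, 0 < c ∧ 0 < C ∧
      ∀ φ t : ℝ, φ ∈ Set.Ioo 0 Real.pi → 0 < t → t ≤ t₀ →
        c * W t φ * (t + Real.pi - φ) ^ (-(N : ℝ)) * t ^ (-(N : ℝ)) ≤
          (negD^[N] (theta t)) φ ∧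
        (negD^[N] (theta t)) φ ≤
          C * W t φ * (t + Real.pi - φ) ^ (-(N : ℝ)) * t ^ (-(N : ℝ)) := by
  set S := ∑' n : ℤ, Real.exp (1 - |(n : ℝ)|) with hS
  have hSpos : 0 < S := summable_expabs.tsum_pos (fun n => (Real.exp_pos _).le) 0 (Real.exp_pos _)
  set b : ℝ := (6 * (N + 1) ^ 2 * Real.exp (50 * (N + 1) ^ 2))⁻¹ with hb
  have hbpos : 0 < b := by positivity
  refine ⟨1, one_pos, b ^ N, 20 ^ N * S, by positivity, by positivity, ?_⟩
  intro φ t hφ ht ht1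
  obtain ⟨g, hg⟩ := lim_g (Real.exp_pos (-t)) (Real.exp_lt_one_iff.2 (by linarith))
  obtain ⟨A, hA, hgA⟩ := g_zero ht (fun u hu => (hg 0 u hu).1)
  rw [negD_iter_s4 hA (fun N u hu => (hg N u hu).2) hgA N φ hφ]
  have hcos : |Real.cos φ| < 2 := by have := Real.abs_cos_le_one φ; linarith
  have hψ : 0 < t + Real.pi - φ := by linarith [hφ.2]
  set T := (t * (t + Real.pi - φ))⁻¹ with hT
  have hTpos : 0 < T := by positivity
  have hTN : (t + Real.pi - φ) ^ (-(N : ℝ)) * t ^ (-(N : ℝ)) = T ^ N := by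
    rw [Real.rpow_neg hψ.le, Real.rpow_neg ht.le, Real.rpow_natCast, Real.rpow_natCast, hT,
      inv_pow, mul_pow, mul_inv, mul_comm]
  have hev : ∀ᶠ m in atTop, N + ⌊(Real.pi - φ) / t⌋₊ ≤ m := eventually_ge_atTop _
  have l0 : Tendsto (fun m => (pp (Real.exp (-t)) m).eval (Real.cos φ)) atTop (𝓝 (A * theta t φ)) := by
    rw [← hgA]; exact (hg 0 _ hcos).1
  have lN := (hg N _ hcos).1
  have lo : (b * T) ^ N * (A * theta t φ) ≤ g N (Real.cos φ) := by
    refine le_of_tendsto_of_tendsto (l0.const_mul _) lN ?_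
    filter_upwards [hev] with m hm
    have := (core ht ht1 hφ N m hm).1
    rwa [Rr, le_div_iff₀ (pp_pos ht m)] at this
  have up : g N (Real.cos φ) ≤ (20 * T) ^ N * (A * theta t φ) := by
    refine le_of_tendsto_of_tendsto lN (l0.const_mul _) ?_
    filter_upwards [hev] with m hm
    have := (core ht ht1 hφ N m hm).2
    rwa [Rr, div_le_iff₀ (pp_pos ht m)] at this
  obtain ⟨th1, th2⟩ := theta_bounds_s4 ht ht1 hφ
  rw [mul_assoc (b ^ N * W t φ), mul_assoc (20 ^ N * S * W t φ), hTN]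
  constructor
  · calc b ^ N * W t φ * T ^ N ≤ b ^ N * theta t φ * T ^ N := by gcongr
      _ = A⁻¹ * ((b * T) ^ N * (A * theta t φ)) := by rw [mul_pow]; field_simp
      _ ≤ _ := by gcongr
  · calc A⁻¹ * g N (Real.cos φ) ≤ A⁻¹ * ((20 * T) ^ N * (A * theta t φ)) := by gcongr
      _ = 20 ^ N * theta t φ * T ^ N := by rw [mul_pow]; field_simp
      _ ≤ 20 ^ N * (W t φ * S) * T ^ N := by gcongr
      _ = _ := by ring
end
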